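/- arXiv:0909.3667 — 2 statements merged into one kernel-verified Lean document; each statement's English description precedes it below -/
import Mathlib

section
/- Let X and Y be independent nonnegative random variables with X ∈ W(α₁, β₁, γ₁, C₁) and Y ∈ W(α₂, β₂, γ₂, C₂). Then the product X·Y belongs to W(α, β, γ, C) with α = α₁α₂/(α₁+α₂), β = β₁^{α₂/(α₁+α₂)} β₂^{α₁/(α₁+α₂)} [ (α₁/α₂)^{α₂/(α₁+α₂)} + (α₂/α₁)^{α₁/(α₁+α₂)} ], γ = (α₁α₂ + 2α₁γ₂ + 2α₂γ₁)/(2(α₁+α₂)), and C = √(2π) C₁ C₂ (α₁+α₂)^{-1/2} (α₁β₁)^{(α₂ - 2γ₁ + 2γ₂)/(2(α₁+α₂))} (α₂β₂)^{(α₁ - 2γ₂ + 2γ₁)/(2(α₁+α₂))}. -/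
open MeasureTheory ProbabilityTheory Filter Set

noncomputable section

/-- A nonnegative random variable `Y` belongs to the asymptotically Weibullian class
`W(a, b, g, c)` if `ℙ(Y > u) = c u^g exp(-b u^a) (1 + o(1))` as `u → ∞`. -/
def MemW {Ω : Type*} [MeasurableSpace Ω] (P : Measure Ω) (Y : Ω → ℝ)
    (a b g c : ℝ) : Prop :=
  Tendsto (fun u : ℝ =>
      (P {ω | u < Y ω}).toReal / (c * u ^ g * Real.exp (-b * u ^ a)))
    atTop (nhds 1)

/-- The phase `(exp (a s) - 1) / a + (exp (-d s) - 1) / d`, which has a minimum at `s = 0`. -/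
def expPhase (a d s : ℝ) : ℝ :=
  (Real.exp (a * s) - 1) / a + (Real.exp (-d * s) - 1) / d

lemma continuous_expPhase (a d : ℝ) : Continuous (expPhase a d) := by
  unfold expPhase
  fun_prop

lemma quadratic_le_expPhase {a d : ℝ} (ha : 0 < a) (hd : 0 < d) (s : ℝ) :
    min a d / 2 * s ^ 2 ≤ expPhase a d s := by
  have key : ∀ {p q : ℝ}, 0 < p → 0 < q → ∀ {t : ℝ}, 0 ≤ t →
      p / 2 * t ^ 2 ≤ (Real.exp (p * t) - 1) / p + (Real.exp (-q * t) - 1) / q := by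
    intro p q hp hq t ht
    have h1 := Real.quadratic_le_exp_of_nonneg (mul_nonneg hp.le ht)
    have h2 := Real.add_one_le_exp (-q * t)
    have h3 : t + p / 2 * t ^ 2 ≤ (Real.exp (p * t) - 1) / p := by
      rw [le_div_iff₀ hp]
      nlinarith
    have h4 : -t ≤ (Real.exp (-q * t) - 1) / q := by
      rw [le_div_iff₀ hq]
      linarith
    linarith
  rcases le_total 0 s with hs | hs
  · calc min a d / 2 * s ^ 2 ≤ a / 2 * s ^ 2 := by gcongr; exact min_le_left _ _
      _ ≤ _ := key ha hd hs
  · calc min a d / 2 * s ^ 2 ≤ d / 2 * (-s) ^ 2 := by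
          rw [neg_sq]; gcongr; exact min_le_right _ _
      _ ≤ (Real.exp (d * -s) - 1) / d + (Real.exp (-a * -s) - 1) / a :=
          key hd ha (neg_nonneg.2 hs)
      _ = expPhase a d s := by
          rw [expPhase, add_comm]; simp

lemma tendsto_sq_mul_exp_sub_one_sub (c : ℝ) :
    Tendsto (fun r : ℝ => r ^ 2 * (Real.exp (c / r) - 1 - c / r)) atTop (nhds (c ^ 2 / 2)) := by
  rw [tendsto_iff_norm_sub_tendsto_zero]
  have hlim : Tendsto (fun r : ℝ => |c| ^ 3 * (2 / 9) / r) atTop (nhds 0) :=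
    tendsto_const_nhds.div_atTop tendsto_id
  refine squeeze_zero' (Eventually.of_forall fun _ => norm_nonneg _) ?_ hlim
  filter_upwards [eventually_ge_atTop (max 1 |c|)] with r hr
  have hr0 : 0 < r := lt_of_lt_of_le one_pos ((le_max_left _ _).trans hr)
  have hle : |c / r| ≤ 1 := by
    rw [abs_div, abs_of_pos hr0, div_le_one hr0]
    exact (le_max_right _ _).trans hr
  have h := Real.exp_bound hle (n := 3) (by norm_num)
  simp only [Finset.sum_range_succ, Finset.sum_range_zero, Nat.factorial] at h
  have e : r ^ 2 * (Real.exp (c / r) - 1 - c / r) - c ^ 2 / 2 =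
      r ^ 2 * (Real.exp (c / r) - (1 + c / r + (c / r) ^ 2 / 2)) := by
    field_simp
    ring
  rw [e, Real.norm_eq_abs, abs_mul, abs_of_pos (pow_pos hr0 2)]
  calc r ^ 2 * |Real.exp (c / r) - (1 + c / r + (c / r) ^ 2 / 2)|
      ≤ r ^ 2 * (|c / r| ^ 3 * (2 / 9)) := by
        gcongr
        norm_num at h ⊢
        convert h using 2
    _ = |c| ^ 3 * (2 / 9) / r := by
        rw [abs_div, abs_of_pos hr0]
        field_simp

lemma tendsto_sq_mul_expPhase {a d : ℝ} (ha : 0 < a) (hd : 0 < d) (v : ℝ) :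
    Tendsto (fun r : ℝ => r ^ 2 * expPhase a d (v / r)) atTop
      (nhds ((a + d) / 2 * v ^ 2)) := by
  have h := ((tendsto_sq_mul_exp_sub_one_sub (a * v)).div_const a).add
    ((tendsto_sq_mul_exp_sub_one_sub (-d * v)).div_const d)
  have e : (a * v) ^ 2 / 2 / a + (-d * v) ^ 2 / 2 / d = (a + d) / 2 * v ^ 2 := by
    field_simp
  rw [e] at h
  refine h.congr' ?_
  filter_upwards [eventually_gt_atTop 0] with r hr
  rw [expPhase, mul_div_assoc a v r, mul_div_assoc (-d) v r]
  field_simp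
  ring

/-- Laplace's method for the phase `expPhase a d`. -/
lemma tendsto_integral_expPhase {a d : ℝ} (ha : 0 < a) (hd : 0 < d) (k M : ℝ)
    {r : ℝ → ℝ} (hr : Tendsto r atTop atTop) {h : ℝ → ℝ → ℝ}
    (hmeas : ∀ u, Measurable (h u)) (hbound : ∀ᶠ u in atTop, ∀ v, |h u v| ≤ M)
    (hlim : ∀ v, Tendsto (fun u => h u v) atTop (nhds 1)) :
    Tendsto (fun u => ∫ v, h u v * (Real.exp (k * (v / r u)) *
      Real.exp (-(r u ^ 2 * expPhase a d (v / r u))))) atTop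
      (nhds (Real.sqrt (2 * Real.pi / (a + d)))) := by
  have hm : 0 < min a d := lt_min ha hd
  have hgauss : ∫ v : ℝ, Real.exp (-((a + d) / 2) * v ^ 2) =
      Real.sqrt (2 * Real.pi / (a + d)) := by
    rw [integral_gaussian]
    congr 1
    field_simp
  rw [← hgauss]
  refine tendsto_integral_filter_of_dominated_convergence
    (fun v => M * (Real.exp (k ^ 2 / min a d) * Real.exp (-(min a d / 4) * v ^ 2))) ?_ ?_ ?_ ?_
  · refine Eventually.of_forall fun u => ((hmeas u).mul ?_).aestronglyMeasurable
    have := continuous_expPhase a d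
    exact Continuous.measurable (by fun_prop)
  · filter_upwards [hbound, hr.eventually_ge_atTop 1] with u hu hr1
    refine Eventually.of_forall fun v => ?_
    have hr0 : 0 < r u := by linarith
    rw [norm_mul, Real.norm_eq_abs, Real.norm_eq_abs, ← Real.exp_add, ← Real.exp_add,
      Real.abs_exp]
    refine mul_le_mul (hu v) (Real.exp_le_exp.2 ?_) (Real.exp_pos _).le
      ((abs_nonneg _).trans (hu v))
    have h1 : min a d / 2 * v ^ 2 ≤ r u ^ 2 * expPhase a d (v / r u) := by
      have := mul_le_mul_of_nonneg_left (quadratic_le_expPhase ha hd (v / r u)) (sq_nonneg (r u))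
      calc _ = r u ^ 2 * (min a d / 2 * (v / r u) ^ 2) := by field_simp
        _ ≤ _ := this
    have h2 : k * (v / r u) ≤ |k| * |v| := by
      calc k * (v / r u) ≤ |k * (v / r u)| := le_abs_self _
        _ = |k| * (|v| / r u) := by rw [abs_mul, abs_div, abs_of_pos hr0]
        _ ≤ |k| * |v| := by
            gcongr
            exact div_le_self (abs_nonneg _) hr1
    have h3 : |k| * |v| ≤ k ^ 2 / min a d + min a d / 4 * v ^ 2 := by
      have e : k ^ 2 / min a d + min a d / 4 * v ^ 2 - |k| * |v| =
          (|k| - min a d / 2 * |v|) ^ 2 / min a d := by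
        rw [← sq_abs k, ← sq_abs v]
        field_simp
        ring
      have : 0 ≤ (|k| - min a d / 2 * |v|) ^ 2 / min a d := by positivity
      linarith
    linarith
  · exact ((integrable_exp_neg_mul_sq (by positivity)).const_mul _).const_mul _
  · refine Eventually.of_forall fun v => ?_
    have h1 : Tendsto (fun u => Real.exp (k * (v / r u))) atTop (nhds 1) := by
      have h0 : Tendsto (fun u => k * (v / r u)) atTop (nhds (k * 0)) :=
        (tendsto_const_nhds.div_atTop hr).const_mul k
      rw [mul_zero] at h0
      simpa [Function.comp_def] using (Real.continuous_exp.tendsto 0).comp h0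
    have h2 := (Real.continuous_exp.tendsto _).comp
      ((tendsto_sq_mul_expPhase ha hd v).comp hr).neg
    have h3 := (hlim v).mul (h1.mul h2)
    rw [one_mul, one_mul, ← neg_mul] at h3
    exact h3

/-- The model tail of the class `W(a, b, g, c)`. -/
def weibullTail (a b g c u : ℝ) : ℝ :=
  c * u ^ g * Real.exp (-b * u ^ a)

/-- The opposite of the derivative of `weibullTail`. -/
def weibullDensity (a b g c t : ℝ) : ℝ :=
  c * t ^ (g - 1) * (a * b * t ^ a - g) * Real.exp (-b * t ^ a)

lemma weibullTail_pos {a b g c u : ℝ} (hc : 0 < c) (hu : 0 < u) :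
    0 < weibullTail a b g c u := by
  unfold weibullTail
  positivity

lemma measurable_weibullDensity (a b g c : ℝ) : Measurable (weibullDensity a b g c) := by
  unfold weibullDensity
  fun_prop

lemma hasDerivAt_weibullTail (a b g c : ℝ) {t : ℝ} (ht : 0 < t) :
    HasDerivAt (weibullTail a b g c) (-weibullDensity a b g c t) t := by
  have h1 := (Real.hasDerivAt_rpow_const (x := t) (p := g) (Or.inl ht.ne')).const_mul c
  have h2 := ((Real.hasDerivAt_rpow_const (x := t) (p := a) (Or.inl ht.ne')).const_mul (-b)).exp
  refine (h1.mul h2).congr_deriv ?_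
  rw [weibullDensity, Real.rpow_sub_one ht.ne', Real.rpow_sub_one ht.ne']
  field_simp
  ring

lemma tendsto_weibullTail {a b : ℝ} (ha : 0 < a) (hb : 0 < b) (g c : ℝ) :
    Tendsto (weibullTail a b g c) atTop (nhds 0) := by
  have h := ((tendsto_rpow_mul_exp_neg_mul_atTop_nhds_zero (g / a) b hb).comp
    (tendsto_rpow_atTop ha)).const_mul c
  rw [mul_zero] at h
  refine h.congr' ?_
  filter_upwards [eventually_gt_atTop 0] with u hu
  rw [Function.comp_apply, ← Real.rpow_mul hu.le, mul_div_cancel₀ _ ha.ne', weibullTail, mul_assoc]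

lemma tendsto_weibullTail_div {a b g c a' b' g' c' k : ℝ} (ha : 0 < a) (hc : 0 < c)
    (haa : a < a') (hb' : 0 < b') (hk : 0 < k) :
    Tendsto (fun u => weibullTail a' b' g' c' (u / k) / weibullTail a b g c u) atTop (nhds 0) := by
  have ha' : 0 < a' := ha.trans haa
  set B : ℝ := b' / k ^ a' with hB
  have hBpos : 0 < B := by positivity
  have hpow : ∀ᶠ u : ℝ in atTop, b * u ^ a ≤ B / 2 * u ^ a' := by
    filter_upwards [(tendsto_rpow_atTop (sub_pos.2 haa)).eventually_ge_atTop (b / (B / 2)),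
      eventually_gt_atTop 0] with u h hu
    rw [div_le_iff₀ (by positivity)] at h
    calc b * u ^ a ≤ u ^ (a' - a) * (B / 2) * u ^ a := by gcongr
      _ = B / 2 * (u ^ (a' - a) * u ^ a) := by ring
      _ = B / 2 * u ^ a' := by rw [← Real.rpow_add hu, sub_add_cancel]
  have hz := (tendsto_weibullTail ha' (half_pos hBpos) (g' - g) (|c'| / k ^ g' / c))
  refine squeeze_zero_norm' ?_ hz
  filter_upwards [hpow, eventually_gt_atTop 0] with u h hu
  have e : weibullTail a' b' g' c' (u / k) / weibullTail a b g c u =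
      c' / k ^ g' / c * u ^ (g' - g) * Real.exp (b * u ^ a - B * u ^ a') := by
    rw [weibullTail, weibullTail, Real.div_rpow hu.le hk.le, Real.div_rpow hu.le hk.le,
      Real.rpow_sub hu, sub_eq_add_neg, Real.exp_add, neg_mul b, Real.exp_neg (b * u ^ a),
      show -b' * (u ^ a' / k ^ a') = -(B * u ^ a') by rw [hB]; ring]
    field_simp
  rw [e, Real.norm_eq_abs, abs_mul, abs_mul, abs_div, abs_div, Real.abs_exp, abs_of_pos hc,
    abs_of_pos (Real.rpow_pos_of_pos hk _), abs_of_pos (Real.rpow_pos_of_pos hu _), weibullTail]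
  gcongr
  linarith

lemma weibullDensity_nonneg {a b g c t : ℝ} (hc : 0 < c) (ht : 0 < t) (h : g ≤ a * b * t ^ a) :
    0 ≤ weibullDensity a b g c t := by
  unfold weibullDensity
  have : 0 ≤ a * b * t ^ a - g := sub_nonneg.2 h
  positivity

lemma continuousOn_weibullDensity (a b g c : ℝ) : ContinuousOn (weibullDensity a b g c) (Ioi 0) := by
  intro t ht
  have ht0 : t ≠ 0 := ne_of_gt ht
  unfold weibullDensity
  refine ContinuousAt.continuousWithinAt ?_
  have h1 := Real.continuousAt_rpow_const t (g - 1) (Or.inl ht0)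
  have h2 := Real.continuousAt_rpow_const t a (Or.inl ht0)
  fun_prop

lemma continuousOn_weibullTail (a b g c : ℝ) : ContinuousOn (weibullTail a b g c) (Ioi 0) :=
  fun _ ht => (hasDerivAt_weibullTail a b g c ht).continuousAt.continuousWithinAt

lemma lintegral_weibullDensity {a b g c x : ℝ} (ha : 0 < a) (hb : 0 < b) (hx : 0 < x)
    (hnn : ∀ t ∈ Ioi x, 0 ≤ weibullDensity a b g c t) :
    ∫⁻ t in Ioi x, ENNReal.ofReal (weibullDensity a b g c t) =
      ENNReal.ofReal (weibullTail a b g c x) := by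
  have hd : ∀ t ∈ Ici x, HasDerivAt (fun t => -weibullTail a b g c t)
      (weibullDensity a b g c t) t := fun t ht => by
    have h := (hasDerivAt_weibullTail a b g c (hx.trans_le ht)).neg
    rwa [neg_neg] at h
  have hlim : Tendsto (fun t => -weibullTail a b g c t) atTop (nhds 0) := by
    simpa using (tendsto_weibullTail ha hb g c).neg
  rw [← ofReal_integral_eq_lintegral_ofReal
    (integrableOn_Ioi_deriv_of_nonneg' hd hnn hlim)
    ((ae_restrict_iff' measurableSet_Ioi).2 (Eventually.of_forall hnn)),
    integral_Ioi_of_hasDerivAt_of_nonneg' hd hnn hlim]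
  simp

/-- The value of the first factor at which `x * y = u` is most likely to be realised, where
`K₁ * x ^ a = K₂ * y ^ d`. -/
def saddle (a d K₁ K₂ u : ℝ) : ℝ :=
  (K₂ / K₁) ^ (1 / (a + d)) * u ^ (d / (a + d))

lemma saddle_pos {a d K₁ K₂ u : ℝ} (hK₁ : 0 < K₁) (hK₂ : 0 < K₂) (hu : 0 < u) :
    0 < saddle a d K₁ K₂ u := by
  unfold saddle
  positivity

lemma tendsto_saddle {a d K₁ K₂ : ℝ} (ha : 0 < a) (hd : 0 < d) (hK₁ : 0 < K₁) (hK₂ : 0 < K₂) :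
    Tendsto (saddle a d K₁ K₂) atTop atTop :=
  (tendsto_rpow_atTop (by positivity)).const_mul_atTop (by positivity)

lemma saddle_mul_saddle {a d K₁ K₂ u : ℝ} (ha : 0 < a) (hd : 0 < d) (hK₁ : 0 < K₁)
    (hK₂ : 0 < K₂) (hu : 0 < u) : saddle a d K₁ K₂ u * saddle d a K₂ K₁ u = u := by
  rw [saddle, saddle, Real.div_rpow hK₂.le hK₁.le, Real.div_rpow hK₁.le hK₂.le, add_comm d a]
  have : u ^ (d / (a + d)) * u ^ (a / (a + d)) = u := by
    rw [← Real.rpow_add hu, ← add_div, add_comm d a, div_self (by positivity), Real.rpow_one]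
  calc _ = u ^ (d / (a + d)) * u ^ (a / (a + d)) := by field_simp
    _ = u := this

lemma mul_saddle_rpow {a d K₁ K₂ u : ℝ} (ha : 0 < a) (hd : 0 < d) (hK₁ : 0 < K₁) (hK₂ : 0 < K₂)
    (hu : 0 < u) :
    K₁ * saddle a d K₁ K₂ u ^ a =
      K₁ ^ (d / (a + d)) * K₂ ^ (a / (a + d)) * u ^ (a * d / (a + d)) := by
  obtain ⟨p, rfl⟩ : ∃ p, Real.exp p = K₁ := ⟨_, Real.exp_log hK₁⟩
  obtain ⟨q, rfl⟩ : ∃ q, Real.exp q = K₂ := ⟨_, Real.exp_log hK₂⟩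
  obtain ⟨w, rfl⟩ : ∃ w, Real.exp w = u := ⟨_, Real.exp_log hu⟩
  simp only [saddle, ← Real.exp_sub, ← Real.exp_mul, ← Real.exp_add]
  congr 1
  field_simp
  ring

lemma mul_saddle_rpow_comm {a d K₁ K₂ u : ℝ} (ha : 0 < a) (hd : 0 < d) (hK₁ : 0 < K₁)
    (hK₂ : 0 < K₂) (hu : 0 < u) :
    K₂ * saddle d a K₂ K₁ u ^ d = K₁ * saddle a d K₁ K₂ u ^ a := by
  rw [mul_saddle_rpow ha hd hK₁ hK₂ hu, mul_saddle_rpow hd ha hK₂ hK₁ hu, add_comm d a,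
    mul_comm d a]
  ring

lemma saddle_exponent {a b d e : ℝ} (ha : 0 < a) (hb : 0 < b) (hd : 0 < d) (he : 0 < e) :
    (a * b) ^ (d / (a + d)) * (d * e) ^ (a / (a + d)) * (1 / a + 1 / d) =
      b ^ (d / (a + d)) * e ^ (a / (a + d)) *
        ((a / d) ^ (d / (a + d)) + (d / a) ^ (a / (a + d))) := by
  have h1 : ∀ z : ℝ, 0 < z → z ^ (a / (a + d)) * z ^ (d / (a + d)) = z := fun z hz => by
    rw [← Real.rpow_add hz, ← add_div, div_self (by positivity), Real.rpow_one]
  rw [Real.mul_rpow ha.le hb.le, Real.mul_rpow hd.le he.le, Real.div_rpow ha.le hd.le,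
    Real.div_rpow hd.le ha.le]
  have e1 : d ^ (d / (a + d)) = d / d ^ (a / (a + d)) := by
    rw [eq_div_iff (by positivity), mul_comm, h1 d hd]
  have e2 : a ^ (a / (a + d)) = a / a ^ (d / (a + d)) := by
    rw [eq_div_iff (by positivity), h1 a ha]
  rw [e1, e2]
  field_simp
  ring

lemma saddle_prefactor {a d K₁ K₂ u : ℝ} (g₁ g₂ : ℝ) (ha : 0 < a) (hd : 0 < d) (hK₁ : 0 < K₁)
    (hK₂ : 0 < K₂) (hu : 0 < u) :
    saddle a d K₁ K₂ u ^ g₁ * saddle d a K₂ K₁ u ^ g₂ *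
        Real.sqrt (K₁ * saddle a d K₁ K₂ u ^ a) =
      K₁ ^ ((d - 2 * g₁ + 2 * g₂) / (2 * (a + d))) *
        K₂ ^ ((a - 2 * g₂ + 2 * g₁) / (2 * (a + d))) *
          u ^ ((a * d + 2 * a * g₂ + 2 * d * g₁) / (2 * (a + d))) := by
  obtain ⟨p, rfl⟩ : ∃ p, Real.exp p = K₁ := ⟨_, Real.exp_log hK₁⟩
  obtain ⟨q, rfl⟩ : ∃ q, Real.exp q = K₂ := ⟨_, Real.exp_log hK₂⟩
  obtain ⟨w, rfl⟩ : ∃ w, Real.exp w = u := ⟨_, Real.exp_log hu⟩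
  simp only [saddle, ← Real.exp_sub, ← Real.exp_mul, ← Real.exp_add, ← Real.exp_half]
  congr 1
  rw [add_comm d a]
  field_simp
  ring

lemma integral_Ioi_eq_integral_exp {x r : ℝ} (hx : 0 < x) (hr : 0 < r) (f : ℝ → ℝ) :
    ∫ t in Ioi 0, f t = ∫ v, x * Real.exp (v / r) / r * f (x * Real.exp (v / r)) := by
  have himg : (fun v => x * Real.exp (v / r)) '' univ = Ioi 0 := by
    ext t
    constructor
    · rintro ⟨v, -, rfl⟩
      exact mul_pos hx (Real.exp_pos _)
    · intro ht
      refine ⟨r * Real.log (t / x), mem_univ _, ?_⟩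
      simp only
      rw [mul_div_cancel_left₀ _ hr.ne', Real.exp_log (div_pos ht hx), mul_div_cancel₀ _ hx.ne']
  have hderiv : ∀ v ∈ (univ : Set ℝ), HasDerivWithinAt (fun v => x * Real.exp (v / r))
      (x * Real.exp (v / r) / r) univ v := fun v _ => by
    have := (((hasDerivAt_id v).div_const r).exp.const_mul x).hasDerivWithinAt (s := univ)
    refine this.congr_deriv ?_
    simp only [id]
    ring
  have hinj : InjOn (fun v => x * Real.exp (v / r)) univ := fun v _ w _ h => by
    have := Real.exp_injective (mul_left_cancel₀ hx.ne' h)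
    field_simp at this
    exact this
  rw [← himg, integral_image_eq_integral_abs_deriv_smul MeasurableSet.univ hderiv hinj,
    setIntegral_univ]
  refine integral_congr_ae (Eventually.of_forall fun v => ?_)
  simp only [smul_eq_mul]
  rw [abs_of_pos (by positivity)]

lemma weibullDensity_mul_weibullTail {a b g₁ c₁ d e g₂ c₂ x y L : ℝ} (ha : 0 < a) (hb : 0 < b)
    (hd : 0 < d) (hx : 0 < x) (hy : 0 < y) (hxL : a * b * x ^ a = L) (hyL : d * e * y ^ d = L)
    (s : ℝ) :
    x * Real.exp s * (weibullDensity a b g₁ c₁ (x * Real.exp s) *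
        weibullTail d e g₂ c₂ (x * y / (x * Real.exp s))) =
      c₁ * c₂ * x ^ g₁ * y ^ g₂ * L * Real.exp (-(L * (1 / a + 1 / d))) *
        ((1 - g₁ / (a * b * (x * Real.exp s) ^ a)) *
          (Real.exp ((g₁ + a - g₂) * s) * Real.exp (-(L * expPhase a d s)))) := by
  have hdiv : x * y / (x * Real.exp s) = y * Real.exp (-s) := by
    rw [Real.exp_neg]
    field_simp
  have hxp : ∀ p : ℝ, (x * Real.exp s) ^ p = x ^ p * Real.exp (s * p) := fun p => by
    rw [Real.mul_rpow hx.le (Real.exp_pos _).le, ← Real.exp_mul]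
  have hyp : ∀ p : ℝ, (y * Real.exp (-s)) ^ p = y ^ p * Real.exp (-s * p) := fun p => by
    rw [Real.mul_rpow hy.le (Real.exp_pos _).le, ← Real.exp_mul]
  have hbx : b * x ^ a = L / a := by rw [← hxL]; field_simp
  have hey : e * y ^ d = L / d := by rw [← hyL]; field_simp
  have hL : 0 < L := by rw [← hxL]; positivity
  rw [weibullDensity, weibullTail, hdiv, hxp, hxp, hyp, hyp, Real.rpow_sub_one hx.ne',
    show -b * (x ^ a * Real.exp (s * a)) = -(L / a * Real.exp (s * a)) by rw [← hbx]; ring,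
    show -e * (y ^ d * Real.exp (-s * d)) = -(L / d * Real.exp (-s * d)) by rw [← hey]; ring,
    show a * b * (x ^ a * Real.exp (s * a)) = L * Real.exp (s * a) by rw [← hxL]; ring]
  have hsplit : 1 - g₁ / (L * Real.exp (s * a)) =
      (L * Real.exp (s * a) - g₁) * Real.exp (-(s * a)) / L := by
    rw [Real.exp_neg]
    field_simp
  have hexp : Real.exp s * Real.exp (s * (g₁ - 1)) * Real.exp (-(L / a * Real.exp (s * a))) *
      Real.exp (-s * g₂) * Real.exp (-(L / d * Real.exp (-s * d))) =
      Real.exp (-(L * (1 / a + 1 / d))) * Real.exp (-(s * a)) * Real.exp ((g₁ + a - g₂) * s) *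
        Real.exp (-(L * expPhase a d s)) := by
    simp only [← Real.exp_add]
    congr 1
    rw [expPhase, mul_comm a s, show -d * s = -s * d by ring]
    field_simp
    ring
  rw [hsplit]
  calc _ = c₁ * c₂ * x ^ g₁ * y ^ g₂ * (L * Real.exp (s * a) - g₁) *
        (Real.exp s * Real.exp (s * (g₁ - 1)) * Real.exp (-(L / a * Real.exp (s * a))) *
          Real.exp (-s * g₂) * Real.exp (-(L / d * Real.exp (-s * d)))) := by
        field_simp
    _ = _ := by
        rw [hexp]
        field_simp

/-- The tail of a product of Weibullian factors, truncated away from the axes and written as an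
integral of a density against a tail, has the expected asymptotics. -/
lemma tendsto_truncated_integral {a b d e c₁ c₂ x₀ y₀ : ℝ} (g₁ g₂ : ℝ) (ha : 0 < a) (hb : 0 < b)
    (hd : 0 < d) (he : 0 < e) (hc₁ : 0 < c₁) (hc₂ : 0 < c₂) (hx₀ : 0 < x₀) (hy₀ : 0 < y₀) :
    Tendsto (fun u => (∫ t in Ioc x₀ (u / y₀),
        weibullDensity a b g₁ c₁ t * weibullTail d e g₂ c₂ (u / t)) /
      weibullTail (a * d / (a + d))
        (b ^ (d / (a + d)) * e ^ (a / (a + d)) *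
          ((a / d) ^ (d / (a + d)) + (d / a) ^ (a / (a + d))))
        ((a * d + 2 * a * g₂ + 2 * d * g₁) / (2 * (a + d)))
        (Real.sqrt (2 * Real.pi) * c₁ * c₂ * (a + d) ^ (-(1 : ℝ) / 2) *
          (a * b) ^ ((d - 2 * g₁ + 2 * g₂) / (2 * (a + d))) *
          (d * e) ^ ((a - 2 * g₂ + 2 * g₁) / (2 * (a + d)))) u) atTop (nhds 1) := by
  have hab : 0 < a * b := by positivity
  have hde : 0 < d * e := by positivity
  set x : ℝ → ℝ := saddle a d (a * b) (d * e) with hxdef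
  set y : ℝ → ℝ := saddle d a (d * e) (a * b) with hydef
  set r : ℝ → ℝ := fun u => Real.sqrt (a * b * x u ^ a) with hrdef
  set h : ℝ → ℝ → ℝ := fun u v => (Ioc x₀ (u / y₀)).indicator
    (fun t => 1 - g₁ / (a * b * t ^ a)) (x u * Real.exp (v / r u)) with hhdef
  have hxtop : Tendsto x atTop atTop := tendsto_saddle ha hd hab hde
  have hytop : Tendsto y atTop atTop := tendsto_saddle hd ha hde hab
  have hrtop : Tendsto r atTop atTop :=
    Real.tendsto_sqrt_atTop.comp
      (((tendsto_rpow_atTop ha).comp hxtop).const_mul_atTop hab)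
  have hmeas : ∀ u, Measurable (h u) := fun u =>
    (Measurable.indicator (by fun_prop) measurableSet_Ioc).comp (by fun_prop)
  have hbound : ∀ᶠ u in atTop, ∀ v, |h u v| ≤ 1 + |g₁| / (a * b * x₀ ^ a) := by
    refine Eventually.of_forall fun u v => ?_
    simp only [hhdef]
    by_cases hm : x u * Real.exp (v / r u) ∈ Ioc x₀ (u / y₀)
    · rw [indicator_of_mem hm]
      refine (abs_sub _ _).trans ?_
      have hpos : 0 < x u * Real.exp (v / r u) := hx₀.trans hm.1
      rw [abs_one, abs_div, abs_of_pos (show 0 < a * b * (x u * Real.exp (v / r u)) ^ a by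
        positivity)]
      gcongr
      exact hm.1.le
    · rw [indicator_of_notMem hm, abs_zero]
      positivity
  have hlim : ∀ v, Tendsto (fun u => h u v) atTop (nhds 1) := by
    intro v
    have hexp : Tendsto (fun u => Real.exp (v / r u)) atTop (nhds 1) := by
      have h0 : Tendsto (fun u => v / r u) atTop (nhds 0) := tendsto_const_nhds.div_atTop hrtop
      simpa [Function.comp_def] using (Real.continuous_exp.tendsto 0).comp h0
    have htop : Tendsto (fun u => x u * Real.exp (v / r u)) atTop atTop :=
      hxtop.atTop_mul_pos one_pos hexp
    have hfac : Tendsto (fun u => 1 - g₁ / (a * b * (x u * Real.exp (v / r u)) ^ a)) atTop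
        (nhds 1) := by
      have h0 : Tendsto (fun u => g₁ / (a * b * (x u * Real.exp (v / r u)) ^ a)) atTop (nhds 0) :=
        tendsto_const_nhds.div_atTop (((tendsto_rpow_atTop ha).comp htop).const_mul_atTop hab)
      simpa using tendsto_const_nhds.sub h0
    refine hfac.congr' ?_
    filter_upwards [htop.eventually_gt_atTop x₀, hexp.eventually_le_const one_lt_two,
      hytop.eventually_ge_atTop (2 * y₀), eventually_gt_atTop 0] with u h1 h2 h3 hu
    have hxu : 0 < x u := saddle_pos hab hde hu
    have hm : x u * Real.exp (v / r u) ∈ Ioc x₀ (u / y₀) := by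
      refine ⟨h1, ?_⟩
      rw [le_div_iff₀ hy₀]
      calc x u * Real.exp (v / r u) * y₀ ≤ x u * 2 * y₀ := by gcongr
        _ = x u * (2 * y₀) := by ring
        _ ≤ x u * y u := by gcongr
        _ = u := saddle_mul_saddle ha hd hab hde hu
    simp only [hhdef]
    rw [indicator_of_mem hm]
  have hmain := (tendsto_integral_expPhase ha hd (g₁ + a - g₂) _ hrtop hmeas hbound hlim).div_const
    (Real.sqrt (2 * Real.pi / (a + d)))
  rw [div_self (Real.sqrt_pos.2 (by positivity)).ne'] at hmain
  refine hmain.congr' ?_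
  filter_upwards [eventually_gt_atTop 0] with u hu
  have hxu : 0 < x u := saddle_pos hab hde hu
  have hyu : 0 < y u := saddle_pos hde hab hu
  have hxy : x u * y u = u := saddle_mul_saddle ha hd hab hde hu
  have hru2 : r u ^ 2 = a * b * x u ^ a := Real.sq_sqrt (by positivity)
  have hru : 0 < r u := Real.sqrt_pos.2 (by positivity)
  have hint : ∫ t in Ioc x₀ (u / y₀),
      weibullDensity a b g₁ c₁ t * weibullTail d e g₂ c₂ (u / t) =
      c₁ * c₂ * x u ^ g₁ * y u ^ g₂ * r u * Real.exp (-(r u ^ 2 * (1 / a + 1 / d))) *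
        ∫ v, h u v * (Real.exp ((g₁ + a - g₂) * (v / r u)) *
          Real.exp (-(r u ^ 2 * expPhase a d (v / r u)))) := by
    rw [← integral_const_mul]
    have hsub : Ioc x₀ (u / y₀) ⊆ Ioi 0 := fun t ht => hx₀.trans ht.1
    rw [← inter_eq_self_of_subset_right hsub, ← setIntegral_indicator measurableSet_Ioc,
      integral_Ioi_eq_integral_exp hxu hru]
    refine integral_congr_ae (Eventually.of_forall fun v => ?_)
    simp only [hhdef]
    by_cases hm : x u * Real.exp (v / r u) ∈ Ioc x₀ (u / y₀)
    · rw [indicator_of_mem hm, indicator_of_mem hm]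
      have key := weibullDensity_mul_weibullTail (g₁ := g₁) (c₁ := c₁) (e := e) (g₂ := g₂)
        (c₂ := c₂) ha hb hd hxu hyu hru2.symm
        ((mul_saddle_rpow_comm ha hd hab hde hu).trans hru2.symm) (v / r u)
      rw [hxy] at key
      rw [div_mul_eq_mul_div, key]
      field_simp
    · rw [indicator_of_notMem hm, indicator_of_notMem hm]
      simp
  have hpre : c₁ * c₂ * x u ^ g₁ * y u ^ g₂ * r u * Real.exp (-(r u ^ 2 * (1 / a + 1 / d))) *
      Real.sqrt (2 * Real.pi / (a + d)) =
      weibullTail (a * d / (a + d))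
        (b ^ (d / (a + d)) * e ^ (a / (a + d)) *
          ((a / d) ^ (d / (a + d)) + (d / a) ^ (a / (a + d))))
        ((a * d + 2 * a * g₂ + 2 * d * g₁) / (2 * (a + d)))
        (Real.sqrt (2 * Real.pi) * c₁ * c₂ * (a + d) ^ (-(1 : ℝ) / 2) *
          (a * b) ^ ((d - 2 * g₁ + 2 * g₂) / (2 * (a + d))) *
          (d * e) ^ ((a - 2 * g₂ + 2 * g₁) / (2 * (a + d)))) u := by
    have hexp : r u ^ 2 * (1 / a + 1 / d) = b ^ (d / (a + d)) * e ^ (a / (a + d)) *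
          ((a / d) ^ (d / (a + d)) + (d / a) ^ (a / (a + d))) * u ^ (a * d / (a + d)) := by
      rw [hru2, hxdef, mul_saddle_rpow ha hd hab hde hu, ← saddle_exponent ha hb hd he]
      ring
    have hsqrt : Real.sqrt (2 * Real.pi / (a + d)) =
        Real.sqrt (2 * Real.pi) * (a + d) ^ (-(1 : ℝ) / 2) := by
      rw [Real.sqrt_div (by positivity), neg_div, Real.rpow_neg (by positivity),
        ← Real.sqrt_eq_rpow, div_eq_mul_inv]
    have hpow := saddle_prefactor g₁ g₂ ha hd hab hde hu
    rw [weibullTail, hexp, hsqrt, neg_mul]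
    calc _ = c₁ * c₂ * Real.sqrt (2 * Real.pi) * (a + d) ^ (-(1 : ℝ) / 2) *
          (x u ^ g₁ * y u ^ g₂ * r u) * Real.exp (-(b ^ (d / (a + d)) * e ^ (a / (a + d)) *
          ((a / d) ^ (d / (a + d)) + (d / a) ^ (a / (a + d))) * u ^ (a * d / (a + d)))) := by ring
      _ = _ := by
          rw [hpow]
          ring
  rw [hint, ← hpre]
  exact (mul_div_mul_left _ _ (by positivity)).symm

lemma measurableSet_lt_mul (u : ℝ) : MeasurableSet {z : ℝ × ℝ | u < z.1 * z.2} :=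
  measurableSet_lt measurable_const (measurable_fst.mul measurable_snd)

lemma setOf_lt_mul {t u : ℝ} (ht : 0 < t) : {y : ℝ | u < t * y} = Ioi (u / t) := by
  ext y
  rw [mem_ofPred_eq, mem_Ioi, div_lt_iff₀' ht]

/-- The tail of a product of independent nonnegative factors is monotone in the tail of the
first factor. -/
lemma prod_lt_mul_mono {μ μ' ν : Measure ℝ} [SFinite μ] [SFinite μ'] [SFinite ν]
    (hν : ∀ᵐ y ∂ν, 0 ≤ y) (h : ∀ x, 0 < x → μ (Ioi x) ≤ μ' (Ioi x)) {u : ℝ} (hu : 0 < u) :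
    μ.prod ν {z | u < z.1 * z.2} ≤ μ'.prod ν {z | u < z.1 * z.2} := by
  rw [Measure.prod_apply_symm (measurableSet_lt_mul u),
    Measure.prod_apply_symm (measurableSet_lt_mul u)]
  refine lintegral_mono_ae ?_
  filter_upwards [hν] with y hy
  rcases hy.eq_or_lt with rfl | hy
  · simp [hu.not_gt]
  · have e : (fun x : ℝ => (x, y)) ⁻¹' {z : ℝ × ℝ | u < z.1 * z.2} = Ioi (u / y) := by
      rw [← setOf_lt_mul hy]
      ext x
      simp [mul_comm y]
    rw [e]
    exact h _ (div_pos hu hy)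

lemma dirac_prod_lt_mul {ν : Measure ℝ} [SFinite ν] {x u : ℝ} (hx : 0 < x) :
    (Measure.dirac x).prod ν {z | u < z.1 * z.2} = ν (Ioi (u / x)) := by
  rw [Measure.prod_apply (measurableSet_lt_mul u), lintegral_dirac, ← setOf_lt_mul hx]
  rfl

/-- The measure on `(x₀, ∞)` with density `weibullDensity a b g c`. -/
def weibullMeasure (a b g c x₀ : ℝ) : Measure ℝ :=
  (volume.restrict (Ioi x₀)).withDensity fun t => ENNReal.ofReal (weibullDensity a b g c t)

instance (a b g c x₀ : ℝ) : SFinite (weibullMeasure a b g c x₀) := by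
  unfold weibullMeasure
  infer_instance

lemma weibullMeasure_Ioi {a b g c x₀ : ℝ} (ha : 0 < a) (hb : 0 < b) (hx₀ : 0 < x₀)
    (hnn : ∀ t ∈ Ioi x₀, 0 ≤ weibullDensity a b g c t) (x : ℝ) :
    weibullMeasure a b g c x₀ (Ioi x) = ENNReal.ofReal (weibullTail a b g c (max x x₀)) := by
  rw [weibullMeasure, withDensity_apply _ measurableSet_Ioi,
    Measure.restrict_restrict measurableSet_Ioi, Ioi_inter_Ioi]
  exact lintegral_weibullDensity ha hb (lt_max_of_lt_right hx₀)
    fun t ht => hnn t ((le_max_right x x₀).trans_lt (mem_Ioi.1 ht))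

lemma weibullMeasure_prod_lt_mul {a b g c x₀ u : ℝ} (hx₀ : 0 < x₀) (ν : Measure ℝ) [SFinite ν] :
    (weibullMeasure a b g c x₀).prod ν {z | u < z.1 * z.2} =
      ∫⁻ t in Ioi x₀, ENNReal.ofReal (weibullDensity a b g c t) * ν (Ioi (u / t)) := by
  rw [Measure.prod_apply (measurableSet_lt_mul u), weibullMeasure,
    lintegral_withDensity_eq_lintegral_mul _ (measurable_weibullDensity a b g c).ennreal_ofReal
      (measurable_measure_prodMk_left (measurableSet_lt_mul u))]
  refine setLIntegral_congr_fun measurableSet_Ioi fun t ht => ?_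
  rw [Pi.mul_apply, ← setOf_lt_mul (hx₀.trans ht)]
  rfl

section Sandwich

variable {a b g₁ c₁ d e g₂ c₂ x₀ y₀ u : ℝ} {ν : Measure ℝ} {k : ℝ}

lemma ofReal_truncated_integral (hc₂ : 0 < c₂) (hx₀ : 0 < x₀)
    (hnn : ∀ t ∈ Ioi x₀, 0 ≤ weibullDensity a b g₁ c₁ t) (hu : 0 < u) :
    ENNReal.ofReal (∫ t in Ioc x₀ (u / y₀),
        weibullDensity a b g₁ c₁ t * weibullTail d e g₂ c₂ (u / t)) =
      ∫⁻ t in Ioc x₀ (u / y₀), ENNReal.ofReal (weibullDensity a b g₁ c₁ t) *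
        ENNReal.ofReal (weibullTail d e g₂ c₂ (u / t)) := by
  have hcont : ContinuousOn
      (fun t => weibullDensity a b g₁ c₁ t * weibullTail d e g₂ c₂ (u / t)) (Ioi 0) := by
    refine (continuousOn_weibullDensity _ _ _ _).mul ((continuousOn_weibullTail d e g₂ c₂).comp
      (continuousOn_const.div continuousOn_id fun t ht => ne_of_gt ht) fun t ht => ?_)
    exact div_pos hu ht
  rw [ofReal_integral_eq_lintegral_ofReal]
  · refine setLIntegral_congr_fun measurableSet_Ioc fun t ht => ?_
    exact ENNReal.ofReal_mul (hnn t ht.1)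
  · exact ((hcont.mono fun t ht => hx₀.trans_le ht.1).integrableOn_Icc
      (μ := volume)).mono_set Ioc_subset_Icc_self
  · refine (ae_restrict_iff' measurableSet_Ioc).2 (Eventually.of_forall fun t ht => ?_)
    exact mul_nonneg (hnn t ht.1) (weibullTail_pos hc₂ (div_pos hu (hx₀.trans ht.1))).le

lemma truncated_integral_le [SFinite ν] (hc₂ : 0 < c₂) (hx₀ : 0 < x₀) (hy₀ : 0 < y₀)
    (hnn : ∀ t ∈ Ioi x₀, 0 ≤ weibullDensity a b g₁ c₁ t)
    (hν : ∀ y, y₀ ≤ y → ENNReal.ofReal (weibullTail d e g₂ c₂ y) ≤ ENNReal.ofReal k * ν (Ioi y))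
    (hu : 0 < u) :
    ENNReal.ofReal (∫ t in Ioc x₀ (u / y₀),
        weibullDensity a b g₁ c₁ t * weibullTail d e g₂ c₂ (u / t)) ≤
      ENNReal.ofReal k * (weibullMeasure a b g₁ c₁ x₀).prod ν {z | u < z.1 * z.2} := by
  rw [ofReal_truncated_integral hc₂ hx₀ hnn hu, weibullMeasure_prod_lt_mul hx₀,
    ← lintegral_const_mul' _ _ ENNReal.ofReal_ne_top]
  refine (setLIntegral_mono' measurableSet_Ioc fun t ht => ?_).trans
    (lintegral_mono_set Ioc_subset_Ioi_self)
  rw [mul_left_comm]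
  gcongr
  refine hν _ ?_
  rw [le_div_comm₀ hy₀ (hx₀.trans ht.1)]
  exact ht.2

lemma weibullMeasure_prod_le [SFinite ν] (ha : 0 < a) (hb : 0 < b) (hc₂ : 0 < c₂)
    (hx₀ : 0 < x₀) (hy₀ : 0 < y₀) (hnn : ∀ t ∈ Ioi x₀, 0 ≤ weibullDensity a b g₁ c₁ t)
    (hν1 : ν univ ≤ 1)
    (hν : ∀ y, y₀ ≤ y → ν (Ioi y) ≤ ENNReal.ofReal k * ENNReal.ofReal (weibullTail d e g₂ c₂ y))
    (hu : x₀ * y₀ ≤ u) :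
    (weibullMeasure a b g₁ c₁ x₀).prod ν {z | u < z.1 * z.2} ≤
      ENNReal.ofReal k * ENNReal.ofReal (∫ t in Ioc x₀ (u / y₀),
        weibullDensity a b g₁ c₁ t * weibullTail d e g₂ c₂ (u / t)) +
      ENNReal.ofReal (weibullTail a b g₁ c₁ (u / y₀)) := by
  have hu0 : 0 < u := (mul_pos hx₀ hy₀).trans_le hu
  have hle : x₀ ≤ u / y₀ := (le_div_iff₀ hy₀).2 hu
  rw [ofReal_truncated_integral hc₂ hx₀ hnn hu0, weibullMeasure_prod_lt_mul hx₀,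
    ← lintegral_const_mul' _ _ ENNReal.ofReal_ne_top,
    ← lintegral_weibullDensity ha hb (hx₀.trans_le hle)
      fun t ht => hnn t (hle.trans_lt (mem_Ioi.1 ht)),
    ← Ioc_union_Ioi_eq_Ioi hle, lintegral_union measurableSet_Ioi Ioc_disjoint_Ioi_same]
  gcongr ?_ + ?_
  · refine setLIntegral_mono' measurableSet_Ioc fun t ht => ?_
    rw [mul_left_comm]
    gcongr
    refine hν _ ?_
    rw [le_div_comm₀ hy₀ (hx₀.trans ht.1)]
    exact ht.2
  · refine lintegral_mono fun t => ?_
    exact mul_le_of_le_one_right' ((measure_mono (subset_univ _)).trans hν1)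

variable {μ : Measure ℝ} [IsProbabilityMeasure μ] [IsProbabilityMeasure ν]

lemma truncated_integral_le_prod (ha : 0 < a) (hb : 0 < b) (hc₂ : 0 < c₂)
    (hx₀ : 0 < x₀) (hy₀ : 0 < y₀) (hk : 0 ≤ k)
    (hnn : ∀ t ∈ Ioi x₀, 0 ≤ weibullDensity a b g₁ c₁ t) (hνnn : ∀ᵐ y ∂ν, 0 ≤ y)
    (hμ : ∀ x, x₀ ≤ x → weibullTail a b g₁ c₁ x ≤ k * μ.real (Ioi x))
    (hν : ∀ y, y₀ ≤ y → weibullTail d e g₂ c₂ y ≤ k * ν.real (Ioi y)) (hu : 0 < u) :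
    ∫ t in Ioc x₀ (u / y₀), weibullDensity a b g₁ c₁ t * weibullTail d e g₂ c₂ (u / t) ≤
      k ^ 2 * (μ.prod ν).real {z | u < z.1 * z.2} := by
  have hconv : ∀ {ρ : Measure ℝ} [IsProbabilityMeasure ρ] {w z : ℝ}, w ≤ k * ρ.real (Ioi z) →
      ENNReal.ofReal w ≤ ENNReal.ofReal k * ρ (Ioi z) := by
    intro ρ _ w z h
    rw [← ofReal_measureReal, ← ENNReal.ofReal_mul hk]
    exact ENNReal.ofReal_le_ofReal h
  have h1 := truncated_integral_le hc₂ hx₀ hy₀ hnn (fun y hy => hconv (hν y hy)) hu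
  have h2 : (weibullMeasure a b g₁ c₁ x₀).prod ν {z | u < z.1 * z.2} ≤
      (ENNReal.ofReal k • μ).prod ν {z | u < z.1 * z.2} := by
    refine prod_lt_mul_mono hνnn (fun x _ => ?_) hu
    rw [weibullMeasure_Ioi ha hb hx₀ hnn, Measure.smul_apply, smul_eq_mul]
    refine (hconv (hμ _ (le_max_right _ _))).trans ?_
    gcongr
    exact le_max_left _ _
  rw [Measure.prod_smul_left, Measure.smul_apply, smul_eq_mul] at h2
  have h3 := h1.trans (mul_le_mul_right h2 _)
  rw [← ofReal_measureReal, ← ENNReal.ofReal_mul hk, ← ENNReal.ofReal_mul hk] at h3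
  rw [pow_two, mul_assoc]
  exact (ENNReal.ofReal_le_ofReal_iff (by positivity)).1 h3

lemma prod_le_truncated_integral (ha : 0 < a) (hb : 0 < b) (hc₁ : 0 < c₁) (hc₂ : 0 < c₂)
    (hx₀ : 0 < x₀) (hy₀ : 0 < y₀) (hk : 0 ≤ k)
    (hnn : ∀ t ∈ Ioi x₀, 0 ≤ weibullDensity a b g₁ c₁ t) (hνnn : ∀ᵐ y ∂ν, 0 ≤ y)
    (hμ : ∀ x, x₀ ≤ x → μ.real (Ioi x) ≤ k * weibullTail a b g₁ c₁ x)
    (hν : ∀ y, y₀ ≤ y → ν.real (Ioi y) ≤ k * weibullTail d e g₂ c₂ y) (hu : x₀ * y₀ ≤ u) :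
    (μ.prod ν).real {z | u < z.1 * z.2} ≤
      k * (k * (∫ t in Ioc x₀ (u / y₀),
        weibullDensity a b g₁ c₁ t * weibullTail d e g₂ c₂ (u / t)) +
      weibullTail a b g₁ c₁ (u / y₀)) + k * weibullTail d e g₂ c₂ (u / x₀) := by
  have hu0 : 0 < u := (mul_pos hx₀ hy₀).trans_le hu
  have hconv : ∀ {ρ : Measure ℝ} [IsProbabilityMeasure ρ] {w z : ℝ}, ρ.real (Ioi z) ≤ k * w →
      ρ (Ioi z) ≤ ENNReal.ofReal k * ENNReal.ofReal w := by
    intro ρ _ w z h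
    rw [← ofReal_measureReal, ← ENNReal.ofReal_mul hk]
    exact ENNReal.ofReal_le_ofReal h
  have h1 := weibullMeasure_prod_le ha hb hc₂ hx₀ hy₀ hnn prob_le_one
    (fun y hy => hconv (hν y hy)) hu
  have h2 : μ.prod ν {z | u < z.1 * z.2} ≤
      (ENNReal.ofReal k • weibullMeasure a b g₁ c₁ x₀ + Measure.dirac x₀).prod ν
        {z | u < z.1 * z.2} := by
    refine prod_lt_mul_mono hνnn (fun x _ => ?_) hu0
    rw [Measure.add_apply, Measure.smul_apply, smul_eq_mul, weibullMeasure_Ioi ha hb hx₀ hnn]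
    rcases lt_or_ge x x₀ with hx | hx
    · rw [Measure.dirac_apply_of_mem (mem_Ioi.2 hx)]
      exact prob_le_one.trans le_add_self
    · rw [max_eq_left hx]
      exact (hconv (hμ x hx)).trans le_self_add
  rw [Measure.add_prod, Measure.add_apply, Measure.prod_smul_left, Measure.smul_apply,
    smul_eq_mul, dirac_prod_lt_mul hx₀] at h2
  have h3 := h2.trans (add_le_add (mul_le_mul_right h1 _)
    (hconv (hν (u / x₀) ((le_div_iff₀ hx₀).2 (by rwa [mul_comm])))))
  have hI : 0 ≤ ∫ t in Ioc x₀ (u / y₀),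
      weibullDensity a b g₁ c₁ t * weibullTail d e g₂ c₂ (u / t) :=
    setIntegral_nonneg measurableSet_Ioc fun t ht =>
      mul_nonneg (hnn t ht.1) (weibullTail_pos hc₂ (div_pos hu0 (hx₀.trans ht.1))).le
  have hG₁ := (weibullTail_pos (a := a) (b := b) (g := g₁) hc₁ (div_pos hu0 hy₀)).le
  have hG₂ := (weibullTail_pos (a := d) (b := e) (g := g₂) hc₂ (div_pos hu0 hx₀)).le
  rw [← ofReal_measureReal, ← ENNReal.ofReal_mul hk, ← ENNReal.ofReal_add (by positivity) hG₁,
    ← ENNReal.ofReal_mul hk, ← ENNReal.ofReal_mul hk,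
    ← ENNReal.ofReal_add (by positivity) (by positivity)] at h3
  exact (ENNReal.ofReal_le_ofReal_iff (by positivity)).1 h3

end Sandwich

/-- A tail equivalent to its model is eventually comparable with it, with constants arbitrarily
close to `1`. -/
lemma eventually_tail_comparable {μ : Measure ℝ} {a b g c k : ℝ} (hc : 0 < c) (hk : 1 < k)
    (h : Tendsto (fun u => μ.real (Ioi u) / weibullTail a b g c u) atTop (nhds 1)) :
    ∀ᶠ x in atTop,
      weibullTail a b g c x ≤ k * μ.real (Ioi x) ∧ μ.real (Ioi x) ≤ k * weibullTail a b g c x := by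
  have hk0 : 0 < k := one_pos.trans hk
  filter_upwards [h.eventually_le_const hk, h.eventually_const_le (inv_lt_one_of_one_lt₀ hk),
    eventually_gt_atTop 0] with x h1 h2 hx
  have hpos : 0 < weibullTail a b g c x := weibullTail_pos hc hx
  rw [div_le_iff₀ hpos] at h1
  rw [le_div_iff₀ hpos, inv_mul_le_iff₀ hk0] at h2
  exact ⟨h2, h1⟩

lemma eventually_weibullDensity_nonneg {a b c : ℝ} (g : ℝ) (ha : 0 < a) (hb : 0 < b) (hc : 0 < c) :
    ∀ᶠ t in atTop, 0 ≤ weibullDensity a b g c t := by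
  filter_upwards [((tendsto_rpow_atTop ha).const_mul_atTop (mul_pos ha hb)).eventually_ge_atTop g,
    eventually_gt_atTop 0] with t h ht
  exact weibullDensity_nonneg hc ht h

/-- The tail of the product of two independent nonnegative factors with Weibullian tails. -/
lemma tendsto_prod_lt_mul_div {μ ν : Measure ℝ} [IsProbabilityMeasure μ] [IsProbabilityMeasure ν]
    (hνnn : ∀ᵐ y ∂ν, 0 ≤ y) {a b g₁ c₁ d e g₂ c₂ : ℝ} (ha : 0 < a) (hb : 0 < b) (hc₁ : 0 < c₁)
    (hd : 0 < d) (he : 0 < e) (hc₂ : 0 < c₂)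
    (hμ : Tendsto (fun u => μ.real (Ioi u) / weibullTail a b g₁ c₁ u) atTop (nhds 1))
    (hν : Tendsto (fun u => ν.real (Ioi u) / weibullTail d e g₂ c₂ u) atTop (nhds 1)) :
    Tendsto (fun u => (μ.prod ν).real {z | u < z.1 * z.2} /
      weibullTail (a * d / (a + d))
        (b ^ (d / (a + d)) * e ^ (a / (a + d)) *
          ((a / d) ^ (d / (a + d)) + (d / a) ^ (a / (a + d))))
        ((a * d + 2 * a * g₂ + 2 * d * g₁) / (2 * (a + d)))
        (Real.sqrt (2 * Real.pi) * c₁ * c₂ * (a + d) ^ (-(1 : ℝ) / 2) *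
          (a * b) ^ ((d - 2 * g₁ + 2 * g₂) / (2 * (a + d))) *
          (d * e) ^ ((a - 2 * g₂ + 2 * g₁) / (2 * (a + d)))) u) atTop (nhds 1) := by
  have htrunc := fun {x₀ y₀ : ℝ} (hx₀ : 0 < x₀) (hy₀ : 0 < y₀) =>
    tendsto_truncated_integral g₁ g₂ ha hb hd he hc₁ hc₂ hx₀ hy₀
  set A := a * d / (a + d) with hA
  set C := Real.sqrt (2 * Real.pi) * c₁ * c₂ * (a + d) ^ (-(1 : ℝ) / 2) *
    (a * b) ^ ((d - 2 * g₁ + 2 * g₂) / (2 * (a + d))) *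
    (d * e) ^ ((a - 2 * g₂ + 2 * g₁) / (2 * (a + d)))
  have hC : 0 < C := by positivity
  have hApos : 0 < A := by positivity
  have hAa : A < a := by rw [hA, div_lt_iff₀ (by positivity)]; nlinarith
  have hAd : A < d := by rw [hA, div_lt_iff₀ (by positivity)]; nlinarith
  set B := b ^ (d / (a + d)) * e ^ (a / (a + d)) *
    ((a / d) ^ (d / (a + d)) + (d / a) ^ (a / (a + d)))
  set G := (a * d + 2 * a * g₂ + 2 * d * g₁) / (2 * (a + d))
  have hchoose : ∀ k, 1 < k → ∃ x₀ y₀ : ℝ, 0 < x₀ ∧ 0 < y₀ ∧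
      (∀ t ∈ Ioi x₀, 0 ≤ weibullDensity a b g₁ c₁ t) ∧
      (∀ x, x₀ ≤ x → weibullTail a b g₁ c₁ x ≤ k * μ.real (Ioi x) ∧
        μ.real (Ioi x) ≤ k * weibullTail a b g₁ c₁ x) ∧
      (∀ y, y₀ ≤ y → weibullTail d e g₂ c₂ y ≤ k * ν.real (Ioi y) ∧
        ν.real (Ioi y) ≤ k * weibullTail d e g₂ c₂ y) := by
    intro k hk
    obtain ⟨x₀, h1, h2, hx₀⟩ :=
      ((eventually_forall_ge_atTop.2 (eventually_weibullDensity_nonneg g₁ ha hb hc₁)).and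
        ((eventually_forall_ge_atTop.2 (eventually_tail_comparable hc₁ hk hμ)).and
          (eventually_gt_atTop 0))).exists
    obtain ⟨y₀, h3, hy₀⟩ :=
      ((eventually_forall_ge_atTop.2 (eventually_tail_comparable hc₂ hk hν)).and
        (eventually_gt_atTop 0)).exists
    exact ⟨x₀, y₀, hx₀, hy₀, fun t ht => h1 t (le_of_lt ht), h2, h3⟩
  have hsq : Tendsto (fun k : ℝ => k ^ 2) (nhdsWithin 1 (Ioi 1)) (nhds 1) := by
    have : Tendsto (fun k : ℝ => k ^ 2) (nhds 1) (nhds (1 ^ 2)) := (continuous_pow 2).tendsto 1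
    rw [one_pow] at this
    exact this.mono_left nhdsWithin_le_nhds
  refine tendsto_order.2 ⟨fun l hl => ?_, fun m hm => ?_⟩
  · have hlk : Tendsto (fun k : ℝ => k ^ 2 * l) (nhdsWithin 1 (Ioi 1)) (nhds l) := by
      simpa using hsq.mul_const l
    obtain ⟨k, hkl, hk⟩ :=
      ((hlk.eventually_lt_const hl).and self_mem_nhdsWithin).exists
    have hk0 : 0 < k := one_pos.trans hk
    obtain ⟨x₀, y₀, hx₀, hy₀, hnn, hx, hy⟩ := hchoose k hk
    filter_upwards [(htrunc hx₀ hy₀).eventually_const_lt hkl, eventually_gt_atTop 0] with u h hu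
    have hle := truncated_integral_le_prod ha hb hc₂ hx₀ hy₀ hk0.le hnn hνnn
      (fun x h => (hx x h).1) (fun y h => (hy y h).1) hu
    have hR : 0 < weibullTail A B G C u := weibullTail_pos hC hu
    rw [lt_div_iff₀ hR] at h ⊢
    rw [mul_assoc] at h
    exact lt_of_mul_lt_mul_left (h.trans_le hle) (by positivity)
  · obtain ⟨k, hkm, hk⟩ := ((hsq.eventually_lt_const hm).and self_mem_nhdsWithin).exists
    have hk0 : 0 < k := one_pos.trans hk
    obtain ⟨x₀, y₀, hx₀, hy₀, hnn, hx, hy⟩ := hchoose k hk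
    have hlim := (((htrunc hx₀ hy₀).const_mul (k ^ 2)).add
      ((tendsto_weibullTail_div (b := B) (g := G) (g' := g₁) (c' := c₁) hApos hC hAa hb
        hy₀).const_mul k)).add
      ((tendsto_weibullTail_div (b := B) (g := G) (g' := g₂) (c' := c₂) hApos hC hAd he
        hx₀).const_mul k)
    simp only [mul_one, mul_zero, add_zero] at hlim
    filter_upwards [hlim.eventually_lt_const hkm, eventually_gt_atTop 0,
      eventually_ge_atTop (x₀ * y₀)] with u h hu hu'
    have hle := prod_le_truncated_integral ha hb hc₁ hc₂ hx₀ hy₀ hk0.le hnn hνnn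
      (fun x h => (hx x h).2) (fun y h => (hy y h).2) hu'
    have hR : 0 < weibullTail A B G C u := weibullTail_pos hC hu
    refine lt_of_le_of_lt ?_ h
    rw [div_le_iff₀ hR]
    refine hle.trans_eq ?_
    field_simp

/-- Lemma 2.1: the product of two independent asymptotically Weibullian random variables
is asymptotically Weibullian, with the indicated parameters. -/
theorem product_of_weibullian {Ω : Type*} [MeasurableSpace Ω] (P : Measure Ω)
    [IsProbabilityMeasure P]
    (X Y : Ω → ℝ) (hXm : Measurable X) (hYm : Measurable Y)
    (hXnn : ∀ ω, 0 ≤ X ω) (hYnn : ∀ ω, 0 ≤ Y ω)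
    (hInd : IndepFun X Y P)
    (α₁ β₁ γ₁ C₁ α₂ β₂ γ₂ C₂ : ℝ)
    (hα₁ : 0 < α₁) (hβ₁ : 0 < β₁) (hC₁ : 0 < C₁)
    (hα₂ : 0 < α₂) (hβ₂ : 0 < β₂) (hC₂ : 0 < C₂)
    (hX : MemW P X α₁ β₁ γ₁ C₁) (hY : MemW P Y α₂ β₂ γ₂ C₂) :
    MemW P (fun ω => X ω * Y ω)
      (α₁ * α₂ / (α₁ + α₂))
      (β₁ ^ (α₂ / (α₁ + α₂)) * β₂ ^ (α₁ / (α₁ + α₂)) *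
        ((α₁ / α₂) ^ (α₂ / (α₁ + α₂)) + (α₂ / α₁) ^ (α₁ / (α₁ + α₂))))
      ((α₁ * α₂ + 2 * α₁ * γ₂ + 2 * α₂ * γ₁) / (2 * (α₁ + α₂)))
      (Real.sqrt (2 * Real.pi) * C₁ * C₂ * (α₁ + α₂) ^ (-(1 : ℝ) / 2) *
        (α₁ * β₁) ^ ((α₂ - 2 * γ₁ + 2 * γ₂) / (2 * (α₁ + α₂))) *
        (α₂ * β₂) ^ ((α₁ - 2 * γ₂ + 2 * γ₁) / (2 * (α₁ + α₂)))) := by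
  have hlaw : ∀ (Z : Ω → ℝ), Measurable Z → ∀ u,
      (P.map Z).real (Ioi u) = (P {ω | u < Z ω}).toReal :=
    fun Z hZ u => by
      rw [measureReal_def, Measure.map_apply hZ measurableSet_Ioi]
      rfl
  have : IsProbabilityMeasure (P.map X) := Measure.isProbabilityMeasure_map hXm.aemeasurable
  have : IsProbabilityMeasure (P.map Y) := Measure.isProbabilityMeasure_map hYm.aemeasurable
  have hprod : ∀ u, ((P.map X).prod (P.map Y)).real {z | u < z.1 * z.2} =
      (P {ω | u < X ω * Y ω}).toReal := fun u => by
    rw [← (indepFun_iff_map_prod_eq_prod_map_map hXm.aemeasurable hYm.aemeasurable).1 hInd,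
      measureReal_def, Measure.map_apply (hXm.prodMk hYm) (measurableSet_lt_mul u)]
    rfl
  have hνnn : ∀ᵐ y ∂(P.map Y), 0 ≤ y :=
    (ae_map_iff hYm.aemeasurable measurableSet_Ici).2 (Eventually.of_forall hYnn)
  have h := tendsto_prod_lt_mul_div hνnn hα₁ hβ₁ hC₁ hα₂ hβ₂ hC₂ (μ := P.map X) (g₁ := γ₁)
    (g₂ := γ₂) (by simp only [hlaw X hXm]; exact hX) (by simp only [hlaw Y hYm]; exact hY)
  simp only [hprod] at h
  exact h
end
end

section
/- Let {X(t) : t ≥ 0} be a centered Gaussian process with stationary increments, a.s. continuous sample paths, X(0) = 0 a.s., and variance function σ²_X satisfying A1–A3, and let T ∈ W(α, β, γ, C) be a nonnegative random variable independent of the process {X(t)}. Then, as u → ∞, ℙ( sup_{s ∈ [0,T]} X(s) > u ) = ℙ( X(T) > u )(1 + o(1)) = ℙ( σ_X(T)·N > u )(1 + o(1)), where N is a standard normal random variable independent of T. -/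
open MeasureTheory ProbabilityTheory Filter Set

noncomputable section

/-- `X` is a centered Gaussian process (indexed by nonnegative times) with covariance
function `K`: every finite linear combination `∑ cᵢ X(tᵢ)` is a centered real Gaussian
with the variance induced by `K`. -/
def IsCenteredGaussianCov {Ω : Type*} [MeasurableSpace Ω] (P : Measure Ω)
    (X : ℝ → Ω → ℝ) (K : ℝ → ℝ → ℝ) : Prop :=
  (∀ t : ℝ, Measurable (X t)) ∧
  ∀ (n : ℕ) (t : Fin n → ℝ) (c : Fin n → ℝ), (∀ i, 0 ≤ t i) →
    ∃ v : NNReal, ((v : ℝ) = ∑ i, ∑ j, c i * c j * K (t i) (t j)) ∧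
      Measure.map (fun ω => ∑ i, c i * X (t i) ω) P = gaussianReal 0 v

/-- The upper tail `x ↦ ℙ(N > x)` of a standard normal random variable `N`. -/
def gaussianTail (x : ℝ) : ℝ := (gaussianReal 0 1).real (Ioi x)

lemma gaussianTail_nonneg (x : ℝ) : 0 ≤ gaussianTail x := measureReal_nonneg

lemma gaussianTail_le_one (x : ℝ) : gaussianTail x ≤ 1 := measureReal_le_one

lemma gaussianTail_antitone : Antitone gaussianTail := fun _ _ h =>
  measureReal_mono (Ioi_subset_Ioi h)

lemma gaussianTail_eq_integral (x : ℝ) :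
    gaussianTail x = ∫ y in Ioi x, gaussianPDFReal 0 1 y := by
  rw [gaussianTail, Measure.real, gaussianReal_apply_eq_integral _ one_ne_zero,
    ENNReal.toReal_ofReal]
  exact integral_nonneg fun _ => gaussianPDFReal_nonneg _ _ _

lemma gaussianPDFReal_zero_one_eq (x : ℝ) :
    gaussianPDFReal 0 1 x = (√(2 * Real.pi))⁻¹ * Real.exp (-x ^ 2 / 2) := by
  simp [gaussianPDFReal]

lemma gaussianPDFReal_zero_one_anti {x y : ℝ} (hx : 0 ≤ x) (hxy : x ≤ y) :
    gaussianPDFReal 0 1 y ≤ gaussianPDFReal 0 1 x := by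
  rw [gaussianPDFReal_zero_one_eq, gaussianPDFReal_zero_one_eq]
  gcongr

lemma gaussianTail_pos (x : ℝ) : 0 < gaussianTail x := by
  refine (gaussianTail_nonneg x).lt_of_ne' fun h => ?_
  rw [gaussianTail, measureReal_eq_zero_iff] at h
  have := gaussianReal_absolutelyContinuous' 0 (v := 1) one_ne_zero h
  simp at this

lemma gaussianTail_add_le {x y : ℝ} (hy : 0 ≤ y) :
    gaussianTail (x + y) ≤ Real.exp (-(x * y) - y ^ 2 / 2) * gaussianTail x := by
  have hint : Integrable (gaussianPDFReal 0 1) := integrable_gaussianPDFReal 0 1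
  have h : gaussianTail (x + y) = ∫ z in Ioi x, gaussianPDFReal 0 1 (z + y) := by
    rw [gaussianTail_eq_integral]
    have := (measurePreserving_add_right volume y).setIntegral_preimage_emb
      (measurableEmbedding_addRight y) (gaussianPDFReal 0 1) (Ioi (x + y))
    simpa using this.symm
  rw [h, gaussianTail_eq_integral, ← integral_const_mul]
  refine setIntegral_mono_on (hint.comp_add_right y).integrableOn
    (hint.const_mul _).integrableOn measurableSet_Ioi fun z hz => ?_
  rw [gaussianPDFReal_zero_one_eq, gaussianPDFReal_zero_one_eq, mul_left_comm, ← Real.exp_add]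
  gcongr
  have : x * y ≤ z * y := by gcongr; exact (mem_Ioi.1 hz).le
  nlinarith

lemma gaussianTail_le_exp {y : ℝ} (hy : 0 ≤ y) :
    gaussianTail y ≤ Real.exp (-(y ^ 2 / 2)) := by
  have := gaussianTail_add_le (x := 0) hy
  rw [zero_add, zero_mul, neg_zero, zero_sub] at this
  exact this.trans (mul_le_of_le_one_right (Real.exp_nonneg _) (gaussianTail_le_one 0))

lemma gaussianTail_eq_add {a b : ℝ} (hab : a ≤ b) :
    gaussianTail a = (∫ y in Ioc a b, gaussianPDFReal 0 1 y) + gaussianTail b := by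
  have hint : Integrable (gaussianPDFReal 0 1) := integrable_gaussianPDFReal 0 1
  rw [gaussianTail_eq_integral, gaussianTail_eq_integral, ← Ioc_union_Ioi_eq_Ioi hab,
    setIntegral_union (Ioc_disjoint_Ioi le_rfl) measurableSet_Ioi hint.integrableOn
      hint.integrableOn]

lemma gaussianTail_sub_div_le {v ε : ℝ} (hv : 1 ≤ v) (hε : 0 ≤ ε) (hε1 : ε ≤ 1) :
    gaussianTail (v - ε / v) ≤ (1 + 13 * ε) * gaussianTail v := by
  have hint : Integrable (gaussianPDFReal 0 1) := integrable_gaussianPDFReal 0 1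
  have hv0 : 0 < v := by linarith
  have hεv : ε / v ≤ v := by rw [div_le_iff₀ hv0]; nlinarith
  have hεv0 : 0 ≤ ε / v := by positivity
  have upper : ∫ y in Ioc (v - ε / v) v, gaussianPDFReal 0 1 y
      ≤ ε / v * gaussianPDFReal 0 1 (v - ε / v) := by
    have := setIntegral_mono_on (μ := volume) (s := Ioc (v - ε / v) v) hint.integrableOn
      (integrableOn_const (C := gaussianPDFReal 0 1 (v - ε / v)) (by simp)) measurableSet_Ioc
      fun z hz => gaussianPDFReal_zero_one_anti (by linarith) hz.1.le
    simpa [hεv0] using this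
  have lower : 1 / v * gaussianPDFReal 0 1 (v + 1 / v) ≤ gaussianTail v := by
    rw [gaussianTail_eq_add (b := v + 1 / v) (by simp [hv0.le])]
    have := setIntegral_mono_on (μ := volume) (s := Ioc v (v + 1 / v))
      (integrableOn_const (C := gaussianPDFReal 0 1 (v + 1 / v)) (by simp))
      hint.integrableOn measurableSet_Ioc
      fun z hz => gaussianPDFReal_zero_one_anti (by linarith [hz.1]) hz.2
    have h0 := gaussianTail_nonneg (v + 1 / v)
    simp [hv0.le] at this
    simp only [one_div] at *
    linarith
  have ratio : gaussianPDFReal 0 1 (v - ε / v) ≤ 13 * gaussianPDFReal 0 1 (v + 1 / v) := by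
    rw [gaussianPDFReal_zero_one_eq, gaussianPDFReal_zero_one_eq, mul_left_comm]
    gcongr
    have h13 : Real.exp (5 / 2) ≤ 13 := by
      have := Real.exp_one_lt_d9
      have h2 : Real.exp (5 / 2) ^ 2 = Real.exp 1 ^ 5 := by
        rw [← Real.exp_nat_mul, ← Real.exp_nat_mul]; norm_num
      have h3 : Real.exp 1 ^ 5 ≤ 2.7182818286 ^ 5 := by gcongr
      refine le_of_sq_le_sq (h2.trans_le (h3.trans (by norm_num))) (by norm_num)
    refine le_trans ?_ (mul_le_mul_of_nonneg_right h13 (Real.exp_nonneg _))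
    rw [← Real.exp_add, Real.exp_le_exp]
    have e1 : v * (ε / v) = ε := by field_simp
    have e2 : v * (1 / v) = 1 := by field_simp
    have e3 : 1 / v ≤ 1 := by rw [div_le_one hv0]; exact hv
    have e4 : 0 ≤ 1 / v := by positivity
    nlinarith [sq_nonneg (ε / v)]
  rw [gaussianTail_eq_add (sub_le_self v hεv0)]
  have : ε / v * gaussianPDFReal 0 1 (v - ε / v) ≤ 13 * ε * gaussianTail v := by
    calc ε / v * gaussianPDFReal 0 1 (v - ε / v)
        ≤ ε / v * (13 * gaussianPDFReal 0 1 (v + 1 / v)) := by gcongr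
      _ = 13 * ε * (1 / v * gaussianPDFReal 0 1 (v + 1 / v)) := by ring
      _ ≤ _ := by gcongr
  linarith

/-- The tail of a centered Gaussian law with variance `σ2 > 0`. -/
lemma gaussianReal_real_Ioi {v : NNReal} (hv : v ≠ 0) (u : ℝ) :
    (gaussianReal 0 v).real (Ioi u) = gaussianTail (u / √v) := by
  have hs : 0 < √(v : ℝ) := Real.sqrt_pos.2 (by positivity)
  have h := gaussianReal_map_const_mul (μ := 0) (v := 1) (√(v : ℝ))
  have h2 : gaussianReal 0 v = (gaussianReal 0 1).map (√(v : ℝ) * ·) := by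
    rw [h, mul_zero, mul_one]
    congr 1
    ext
    simp [Real.sq_sqrt]
  rw [h2, map_measureReal_apply (by fun_prop) measurableSet_Ioi, gaussianTail]
  congr 1
  ext x
  simp [div_lt_iff₀ hs, mul_comm]

lemma gaussianReal_real_Ioi_le {v : NNReal} {b u : ℝ} (hvb : (v : ℝ) ≤ b)
    (hu : 0 ≤ u) : (gaussianReal 0 v).real (Ioi u) ≤ Real.exp (-(u ^ 2 / (2 * b))) := by
  rcases eq_or_ne v 0 with rfl | hv
  · simp only [gaussianReal_zero_var, Measure.real]
    rw [Measure.dirac_apply' _ measurableSet_Ioi, indicator_of_notMem (by simpa using hu)]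
    simp [Real.exp_nonneg]
  · rw [gaussianReal_real_Ioi hv]
    refine (gaussianTail_le_exp (by positivity)).trans (Real.exp_le_exp.2 (neg_le_neg ?_))
    have hv' : (0 : ℝ) < v := by positivity
    rw [div_pow, Real.sq_sqrt hv'.le, div_div, mul_comm (v : ℝ)]
    gcongr

/-- The two-dimensional marginals of a centered Gaussian process with stationary increments and
convex variance function `σ2` vanishing at the origin. -/
structure IsConvexGaussian {Ω : Type*} [MeasurableSpace Ω] (P : Measure Ω)
    (X : ℝ → Ω → ℝ) (σ2 : ℝ → ℝ) : Prop where
  measurable : ∀ t, Measurable (X t)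
  law_add : ∀ s t a b : ℝ, 0 ≤ s → 0 ≤ t → ∃ v : NNReal,
    (v : ℝ) = a ^ 2 * σ2 s + b ^ 2 * σ2 t + a * b * (σ2 s + σ2 t - σ2 |t - s|) ∧
      P.map (fun ω => a * X s ω + b * X t ω) = gaussianReal 0 v
  zero : σ2 0 = 0
  convexOn : ConvexOn ℝ (Ici 0) σ2

namespace IsConvexGaussian

variable {Ω : Type*} [MeasurableSpace Ω] {P : Measure Ω} {X : ℝ → Ω → ℝ} {σ2 : ℝ → ℝ}

lemma law (h : IsConvexGaussian P X σ2) {t : ℝ} (ht : 0 ≤ t) :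
    ∃ v : NNReal, (v : ℝ) = σ2 t ∧ P.map (X t) = gaussianReal 0 v := by
  obtain ⟨v, hv, hl⟩ := h.law_add t t 1 0 ht ht
  refine ⟨v, by simpa using hv, ?_⟩
  simpa using hl

lemma nonneg (h : IsConvexGaussian P X σ2) {t : ℝ} (ht : 0 ≤ t) : 0 ≤ σ2 t := by
  obtain ⟨v, hv, -⟩ := h.law ht
  exact hv ▸ v.2

lemma scale_le (h : IsConvexGaussian P X σ2) {x t : ℝ} (hx : 0 ≤ x) (hx1 : x ≤ 1) (ht : 0 ≤ t) :
    σ2 (x * t) ≤ x * σ2 t := by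
  have := h.convexOn.2 (mem_Ici.2 ht) (mem_Ici.2 le_rfl) hx (sub_nonneg.2 hx1) (by ring)
  simpa [h.zero] using this

lemma superadd (h : IsConvexGaussian P X σ2) {s t : ℝ} (hs : 0 ≤ s) (ht : 0 ≤ t) :
    σ2 s + σ2 t ≤ σ2 (s + t) := by
  rcases (add_nonneg hs ht).eq_or_lt' with h0 | hpos
  · have h1 : s = 0 := by linarith
    have h2 : t = 0 := by linarith
    simp [h1, h2, h.zero]
  · have e1 := h.scale_le (x := s / (s + t)) (t := s + t) (by positivity)
      (by rw [div_le_one hpos]; linarith) hpos.le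
    have e2 := h.scale_le (x := t / (s + t)) (t := s + t) (by positivity)
      (by rw [div_le_one hpos]; linarith) hpos.le
    rw [div_mul_cancel₀ _ hpos.ne'] at e1 e2
    have : s / (s + t) * σ2 (s + t) + t / (s + t) * σ2 (s + t) = σ2 (s + t) := by
      field_simp
    linarith

lemma mono (h : IsConvexGaussian P X σ2) {s t : ℝ} (hs : 0 ≤ s) (hst : s ≤ t) :
    σ2 s ≤ σ2 t := by
  have := h.superadd hs (sub_nonneg.2 hst)
  rw [add_sub_cancel] at this
  linarith [h.nonneg (sub_nonneg.2 hst)]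

lemma tail_eq (h : IsConvexGaussian P X σ2) {t : ℝ} (ht : 0 ≤ t) (hpos : 0 < σ2 t) (u : ℝ) :
    P.real {ω | u < X t ω} = gaussianTail (u / √(σ2 t)) := by
  obtain ⟨v, hv, hl⟩ := h.law ht
  rw [← hv, ← gaussianReal_real_Ioi (by rintro rfl; simp at hv; linarith), ← hl,
    map_measureReal_apply (h.measurable t) measurableSet_Ioi]
  rfl

lemma tail_eq_zero (h : IsConvexGaussian P X σ2) {t : ℝ} (ht : 0 ≤ t) (h0 : σ2 t = 0) {u : ℝ}
    (hu : 0 ≤ u) : P.real {ω | u < X t ω} = 0 := by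
  obtain ⟨v, hv, hl⟩ := h.law ht
  have hv0 : v = 0 := by ext; simpa [h0] using hv
  have : P.real (X t ⁻¹' Ioi u) = 0 := by
    rw [← map_measureReal_apply (h.measurable t) measurableSet_Ioi, hl, hv0,
      gaussianReal_zero_var, Measure.real, Measure.dirac_apply' _ measurableSet_Ioi,
      indicator_of_notMem (by simpa using hu)]
    rfl
  exact this

/-- Exceedance probabilities decay geometrically as the time moves back from `t`. -/
lemma tail_scale_le (h : IsConvexGaussian P X σ2) {x t u : ℝ} (hx : 0 ≤ x) (hx1 : x ≤ 1)
    (ht : 0 ≤ t) (hpos : 0 < σ2 t) (hu : 0 ≤ u) :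
    P.real {ω | u < X (x * t) ω} ≤
      Real.exp (-(u ^ 2 / σ2 t * (1 - x) / 3)) * gaussianTail (u / √(σ2 t)) := by
  have hxt : 0 ≤ x * t := mul_nonneg hx ht
  rcases (h.nonneg hxt).eq_or_lt' with h0 | hpos'
  · rw [h.tail_eq_zero hxt h0 hu]
    exact mul_nonneg (Real.exp_nonneg _) (gaussianTail_nonneg _)
  rw [h.tail_eq hxt hpos']
  have hs : 0 < √(σ2 t) := Real.sqrt_pos.2 hpos
  have hs' : 0 < √(σ2 (x * t)) := Real.sqrt_pos.2 hpos'
  set v := u / √(σ2 t) with hv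
  have hv0 : 0 ≤ v := by positivity
  have hv2 : v ^ 2 = u ^ 2 / σ2 t := by rw [hv, div_pow, Real.sq_sqrt hpos.le]
  have hle : v + v * (1 - x) / 3 ≤ u / √(σ2 (x * t)) := by
    have hu' : u = v * √(σ2 t) := by rw [hv]; field_simp
    rw [le_div_iff₀ hs', hu']
    have key : (1 + (1 - x) / 3) * √(σ2 (x * t)) ≤ √(σ2 t) := by
      refine Real.le_sqrt_of_sq_le ?_
      rw [mul_pow, Real.sq_sqrt hpos'.le]
      have h1 := h.scale_le hx hx1 ht
      have h2 : (1 + (1 - x) / 3) ^ 2 * x ≤ 1 := by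
        nlinarith [mul_nonneg hx (sub_nonneg.2 hx1), mul_nonneg hx hx, sq_nonneg (1 - x),
          mul_nonneg hx (sq_nonneg (1 - x))]
      calc (1 + (1 - x) / 3) ^ 2 * σ2 (x * t) ≤ (1 + (1 - x) / 3) ^ 2 * (x * σ2 t) := by gcongr
        _ = ((1 + (1 - x) / 3) ^ 2 * x) * σ2 t := by ring
        _ ≤ 1 * σ2 t := by gcongr
        _ = _ := one_mul _
    nlinarith
  refine (gaussianTail_antitone hle).trans ((gaussianTail_add_le
    (div_nonneg (mul_nonneg hv0 (sub_nonneg.2 hx1)) zero_le_three)).trans ?_)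
  refine mul_le_mul_of_nonneg_right (Real.exp_le_exp.2 ?_) (gaussianTail_nonneg _)
  rw [← hv2]
  nlinarith [sq_nonneg (v * (1 - x) / 3)]

variable [IsProbabilityMeasure P]

/-- Increments over an interval starting at `s`, seen from the right end, are negatively
correlated with `X s`, so exceedances of both are bounded by the product of the bounds. -/
lemma measure_exceed_and_drop_le (h : IsConvexGaussian P X σ2) {s t u y b : ℝ} (hs : 0 ≤ s)
    (hst : s ≤ t) (hu : 0 ≤ u) (hy : 0 ≤ y) (hσ : σ2 (t - s) ≤ b) :
    P.real {ω | u < X s ω ∧ y < X s ω - X t ω} ≤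
      P.real {ω | u < X s ω} * Real.exp (-(y ^ 2 / (2 * b))) := by
  have ht : 0 ≤ t := hs.trans hst
  rcases (h.nonneg hs).eq_or_lt' with h0 | hpos
  · have hz := h.tail_eq_zero hs h0 hu
    rw [hz, zero_mul]
    exact (measureReal_mono fun ω hω => hω.1).trans hz.le
  set c : ℝ := (σ2 t - σ2 s - σ2 (t - s)) / (2 * σ2 s) with hc
  have hc0 : 0 ≤ c := by
    have := h.superadd hs (sub_nonneg.2 hst)
    rw [add_sub_cancel] at this
    exact div_nonneg (by linarith) (by linarith)
  have hcmul : c * (2 * σ2 s) = σ2 t - σ2 s - σ2 (t - s) := div_mul_cancel₀ _ (by positivity)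
  set W : Ω → ℝ := fun ω => (1 + c) * X s ω + (-1) * X t ω with hW
  have hX := h.measurable s
  have hWm : Measurable W := (hX.const_mul _).add ((h.measurable t).const_mul _)
  obtain ⟨vW, hvW, hlW⟩ := h.law_add s t (1 + c) (-1) hs ht
  obtain ⟨vX, hvX, hlX⟩ := h.law hs
  rw [abs_of_nonneg (sub_nonneg.2 hst)] at hvW
  have hvW' : (vW : ℝ) = σ2 (t - s) - c ^ 2 * σ2 s := by rw [hvW]; linear_combination c * hcmul
  have hind : IndepFun (X s) W P := by
    rw [indepFun_iff_charFunDual_prod hX.aemeasurable hWm.aemeasurable]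
    intro L
    rw [charFunDual_eq_charFun_map_one, charFunDual_eq_charFun_map_one,
      charFunDual_eq_charFun_map_one, Measure.map_map (by fun_prop) (by fun_prop),
      Measure.map_map (by fun_prop) (by fun_prop), Measure.map_map (by fun_prop) (by fun_prop)]
    have hL : ∀ x y : ℝ, L (x, y) = x * L (1, 0) + y * L (0, 1) := fun x y => by
      have : ((x, y) : ℝ × ℝ) = x • (1, 0) + y • (0, 1) := by simp
      rw [this, map_add, map_smul, map_smul, smul_eq_mul, smul_eq_mul]
    set p := L (1, 0)
    set q := L (0, 1)
    obtain ⟨v, hv, hl⟩ := h.law_add s t (p + q * (1 + c)) (-q) hs ht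
    rw [abs_of_nonneg (sub_nonneg.2 hst)] at hv
    have e1 : (⇑L ∘ fun ω => (X s ω, W ω)) =
        fun ω => (p + q * (1 + c)) * X s ω + (-q) * X t ω := by
      ext ω
      simp only [Function.comp, hL, hW]
      ring
    have e2 : (⇑(L.comp (.inl ℝ ℝ ℝ)) ∘ X s) = (p * ·) ∘ X s := by
      ext ω
      simp [hL, mul_comm]
    have e3 : (⇑(L.comp (.inr ℝ ℝ ℝ)) ∘ W) = (q * ·) ∘ W := by
      ext ω
      simp [hL, mul_comm]
    rw [e1, e2, e3, hl, ← Measure.map_map (by fun_prop) hX, ← Measure.map_map (by fun_prop) hWm,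
      hlX, hlW, gaussianReal_map_const_mul, gaussianReal_map_const_mul, charFun_gaussianReal,
      charFun_gaussianReal, charFun_gaussianReal, ← Complex.exp_add]
    congr 1
    have : (v : ℝ) = p ^ 2 * vX + q ^ 2 * vW := by
      rw [hv, hvX, hvW']
      linear_combination (p * q + c * q ^ 2) * hcmul
    have hC : ((v : ℝ) : ℂ) = (p : ℂ) ^ 2 * ((vX : ℝ) : ℂ) + (q : ℂ) ^ 2 * ((vW : ℝ) : ℂ) := by
      rw [this]; push_cast; ring
    simp only [mul_zero, Complex.ofReal_zero, zero_mul, NNReal.coe_mul, NNReal.coe_mk,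
      Complex.ofReal_mul, Complex.ofReal_pow]
    rw [hC]
    ring
  calc P.real {ω | u < X s ω ∧ y < X s ω - X t ω}
      ≤ P.real (X s ⁻¹' Ioi u ∩ W ⁻¹' Ioi y) := by
        refine measureReal_mono fun ω hω => ⟨hω.1, ?_⟩
        have : 0 ≤ c * X s ω := mul_nonneg hc0 (hu.trans hω.1.le)
        have := hω.2
        simp only [hW, mem_preimage, mem_Ioi]
        linarith
    _ = P.real (X s ⁻¹' Ioi u) * P.real (W ⁻¹' Ioi y) := by
        simp only [Measure.real, ← ENNReal.toReal_mul]
        rw [hind.measure_inter_preimage_eq_mul _ _ measurableSet_Ioi measurableSet_Ioi]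
    _ ≤ _ := by
        refine mul_le_mul_of_nonneg_left ?_ measureReal_nonneg
        rw [← map_measureReal_apply hWm measurableSet_Ioi, hlW]
        refine gaussianReal_real_Ioi_le ?_ hy
        nlinarith [sq_nonneg c]

end IsConvexGaussian

lemma sum_exp_neg_mul_le {r : ℝ} (hr : 0 < r) (N : ℕ) :
    ∑ i ∈ Finset.range N, Real.exp (-(r * i)) ≤ 1 + 1 / r := by
  have h1 : Real.exp (-r) < 1 := by simpa using hr
  have h0 : 0 < 1 - Real.exp (-r) := by linarith
  have e : ∀ i : ℕ, Real.exp (-(r * i)) = Real.exp (-r) ^ i := fun i => by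
    rw [← Real.exp_nat_mul]; congr 1; ring
  simp_rw [e]
  refine ((summable_geometric_of_lt_one (Real.exp_nonneg _) h1).sum_le_tsum _
    fun i _ => by positivity).trans ?_
  rw [tsum_geometric_of_lt_one (Real.exp_nonneg _) h1, inv_le_comm₀ h0 (by positivity)]
  have hle : Real.exp (-r) ≤ 1 / (1 + r) := by
    rw [Real.exp_neg, ← one_div]
    exact one_div_le_one_div_of_le (by positivity) (by linarith [Real.add_one_le_exp r])
  have : (1 + 1 / r)⁻¹ = 1 - 1 / (1 + r) := by field_simp; ring
  linarith

lemma sum_two_pow_mul_exp_le {c : ℝ} (hc : 0 < c) (n : ℕ) :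
    ∑ k ∈ Finset.range n, (2 : ℝ) ^ k * Real.exp (-(c * (32 / 25) ^ k)) ≤ 96 / c ^ 4 := by
  have hterm : ∀ k : ℕ, (2 : ℝ) ^ k * Real.exp (-(c * (32 / 25) ^ k)) ≤
      24 / c ^ 4 * (2 * (25 / 32) ^ 4) ^ k := fun k => by
    have hx : 0 < c * (32 / 25 : ℝ) ^ k := by positivity
    have h := Real.pow_div_factorial_le_exp _ hx.le 4
    have h' : Real.exp (-(c * (32 / 25) ^ k)) ≤ 24 / (c * (32 / 25 : ℝ) ^ k) ^ 4 := by
      rw [Real.exp_neg, inv_le_comm₀ (Real.exp_pos _) (by positivity), inv_div]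
      simpa [Nat.factorial] using h
    calc _ ≤ (2 : ℝ) ^ k * (24 / (c * (32 / 25 : ℝ) ^ k) ^ 4) := by gcongr
      _ = _ := by
        have : (2 * (25 / 32 : ℝ) ^ 4) ^ k = 2 ^ k / ((32 / 25) ^ k) ^ 4 := by
          have e : (25 / 32 : ℝ) = (32 / 25)⁻¹ := by norm_num
          rw [e, mul_pow, inv_pow, inv_pow, ← pow_mul, ← pow_mul, mul_comm 4 k,
            ← div_eq_mul_inv]
        rw [this, mul_pow]
        field_simp
  refine (Finset.sum_le_sum fun k _ => hterm k).trans ?_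
  rw [← Finset.mul_sum]
  have : ∑ k ∈ Finset.range n, (2 * (25 / 32 : ℝ) ^ 4) ^ k ≤ 4 := by
    refine ((summable_geometric_of_lt_one (by norm_num) (by norm_num)).sum_le_tsum _
      fun i _ => by positivity).trans ?_
    rw [tsum_geometric_of_lt_one (by norm_num) (by norm_num)]
    norm_num
  calc _ ≤ 24 / c ^ 4 * 4 := by gcongr
    _ = _ := by ring

namespace IsConvexGaussian

variable {Ω : Type*} [MeasurableSpace Ω] {P : Measure Ω} {X : ℝ → Ω → ℝ} {σ2 : ℝ → ℝ}

lemma sum_grid_tail_le (h : IsConvexGaussian P X σ2) {t u : ℝ} (ht : 0 ≤ t) (hpos : 0 < σ2 t)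
    (hu : 0 < u) {N : ℕ} (hN : 0 < N) :
    ∑ j ∈ Finset.range N, P.real {ω | u < X (((j + 1 : ℕ) : ℝ) / N * t) ω} ≤
      (1 + 3 * N / (u ^ 2 / σ2 t)) * gaussianTail (u / √(σ2 t)) := by
  have hN' : (0 : ℝ) < N := by exact_mod_cast hN
  set V := u ^ 2 / σ2 t with hV
  have hV0 : 0 < V := by positivity
  have hterm : ∀ j ∈ Finset.range N, P.real {ω | u < X (((j + 1 : ℕ) : ℝ) / N * t) ω} ≤
      Real.exp (-(V / (3 * N) * ((N - 1 - j : ℕ) : ℝ))) * gaussianTail (u / √(σ2 t)) := by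
    intro j hj
    have hj' : j + 1 ≤ N := Finset.mem_range.1 hj
    have hjc : ((j + 1 : ℕ) : ℝ) ≤ N := by exact_mod_cast hj'
    refine (h.tail_scale_le (x := ((j + 1 : ℕ) : ℝ) / N) (by positivity)
      ((div_le_one hN').2 hjc) ht hpos hu.le).trans (le_of_eq ?_)
    rw [← hV]
    congr 3
    rw [Nat.sub_sub, Nat.add_comm 1 j, Nat.cast_sub hj']
    field_simp
  refine (Finset.sum_le_sum hterm).trans ?_
  rw [← Finset.sum_mul, Finset.sum_range_reflect
    (fun i : ℕ => Real.exp (-(V / (3 * N) * (i : ℝ)))) N]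
  refine mul_le_mul_of_nonneg_right ((sum_exp_neg_mul_le (by positivity) N).trans (le_of_eq ?_))
    (gaussianTail_nonneg _)
  field_simp

variable [IsProbabilityMeasure P]

/-- Passing from the grid with `M` points to the grid with `2 * M` points while raising the
level from `u` to `u + y`. -/
lemma grid_refine_le (h : IsConvexGaussian P X σ2) {t u₀ u y b : ℝ} (ht : 0 ≤ t)
    (hpos : 0 < σ2 t) (hu₀ : 0 < u₀) (huu : u₀ ≤ u) (hy : 0 ≤ y) {M : ℕ} (hM : 0 < M)
    (hb : σ2 (t / (2 * M)) ≤ b) :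
    P.real {ω | ∃ j < 2 * M, u + y < X (((j + 1 : ℕ) : ℝ) / (2 * M : ℕ) * t) ω} ≤
      P.real {ω | ∃ j < M, u < X (((j + 1 : ℕ) : ℝ) / M * t) ω} +
      (1 + 3 * (2 * M : ℕ) / (u₀ ^ 2 / σ2 t)) * gaussianTail (u₀ / √(σ2 t)) *
        Real.exp (-(y ^ 2 / (2 * b))) := by
  have hM' : (0 : ℝ) < M := by exact_mod_cast hM
  set s : ℕ → ℝ := fun j => ((j + 1 : ℕ) : ℝ) / (2 * M : ℕ) * t with hs
  have hs0 : ∀ j, 0 ≤ s j := fun j => by positivity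
  have hsub : {ω | ∃ j < 2 * M, u + y < X (s j) ω} ⊆
      {ω | ∃ j < M, u < X (((j + 1 : ℕ) : ℝ) / M * t) ω} ∪
      ⋃ j ∈ Finset.range (2 * M),
        {ω | u₀ < X (s j) ω ∧ y < X (s j) ω - X (s (j + 1)) ω} := by
    rintro ω ⟨j, hj, hjX⟩
    rcases Nat.even_or_odd' j with ⟨i, rfl | rfl⟩
    · by_cases hi : u < X (s (2 * i + 1)) ω
      · refine Or.inl ⟨i, by omega, ?_⟩
        convert! hi using 2
        simp only [hs]
        push_cast
        field_simp
        ring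
      · refine Or.inr (mem_biUnion (Finset.mem_coe.2 (Finset.mem_range.2 hj)) ⟨?_, ?_⟩) <;>
          linarith
    · refine Or.inl ⟨i, by omega, ?_⟩
      refine (le_add_of_nonneg_right hy).trans_lt ?_
      convert! hjX using 2
      simp only [hs]
      push_cast
      field_simp
      ring
  refine (measureReal_mono hsub).trans ((measureReal_union_le _ _).trans ?_)
  refine add_le_add le_rfl ((measureReal_biUnion_finset_le _ _).trans ?_)
  have hstep : ∀ j, s (j + 1) - s j = t / (2 * M) := fun j => by
    simp only [hs]; push_cast; field_simp; ring
  calc _ ≤ ∑ j ∈ Finset.range (2 * M),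
        P.real {ω | u₀ < X (s j) ω} * Real.exp (-(y ^ 2 / (2 * b))) := by
        refine Finset.sum_le_sum fun j _ =>
          h.measure_exceed_and_drop_le (hs0 j) ?_ hu₀.le hy ((hstep j).symm ▸ hb)
        have : 0 ≤ t / (2 * M) := by positivity
        linarith [hstep j]
    _ ≤ _ := by
        rw [← Finset.sum_mul]
        exact mul_le_mul_of_nonneg_right (h.sum_grid_tail_le ht hpos hu₀ (by omega))
          (Real.exp_nonneg _)

end IsConvexGaussian

namespace IsConvexGaussian

variable {Ω : Type*} [MeasurableSpace Ω] {P : Measure Ω} {X : ℝ → Ω → ℝ} {σ2 : ℝ → ℝ}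
  [IsProbabilityMeasure P]

set_option maxHeartbeats 800000 in
/-- Chaining bound on the dyadic refinements of the grid with `m` points on `[0, t]`. -/
lemma dyadic_grid_le (h : IsConvexGaussian P X σ2) {t u ε Λ : ℝ} (ht : 0 < t) (hpos : 0 < σ2 t)
    (hu : 0 < u) (hε : 0 < ε) (hε1 : ε ≤ 1) (hv : 4 ≤ u ^ 2 / σ2 t) {m : ℕ} (hm : 0 < m)
    (hm_le : m ≤ ε * (u ^ 2 / σ2 t)) (hm_ge : ε * (u ^ 2 / σ2 t) ≤ 2 * m) (hΛ : 0 < Λ)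
    (hvar : m * σ2 (t / m) * Λ ≤ σ2 t) (hΛε : 1248 ≤ ε * (ε ^ 3 * Λ / 50) ^ 4) (n : ℕ) :
    P.real {ω | ∃ j < m * 2 ^ n, u < X (((j + 1 : ℕ) : ℝ) / (m * 2 ^ n : ℕ) * t) ω} ≤
      (1 + 111 * ε) * gaussianTail (u / √(σ2 t)) := by
  have hm' : (0 : ℝ) < m := by exact_mod_cast hm
  set S := √(σ2 t) with hS
  have hS0 : 0 < S := Real.sqrt_pos.2 hpos
  have hS2 : S ^ 2 = σ2 t := Real.sq_sqrt hpos.le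
  set v := u / S with hvdef
  have hv0 : 0 < v := by positivity
  have hv2 : v ^ 2 = u ^ 2 / σ2 t := by rw [hvdef, div_pow, hS2]
  rw [← hv2] at hv hm_le hm_ge
  have hv_two : 2 ≤ v := by nlinarith
  have huv : u = v * S := by rw [hvdef]; field_simp
  set lev : ℕ → ℝ := fun k => u - ε * S / v * (4 / 5) ^ k with hlev
  have hεSv : 0 < ε * S / v := by positivity
  have hlev0 : lev 0 = (v - ε / v) * S := by simp only [hlev, huv, pow_zero]; ring
  have hεv : ε / v ≤ 1 / 2 := by rw [div_le_iff₀ hv0]; linarith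
  have hlev0_pos : 0 < lev 0 := by rw [hlev0]; apply mul_pos _ hS0; linarith
  have hlev_ge : ∀ k, lev 0 ≤ lev k := fun k => by
    have : (4 / 5 : ℝ) ^ k ≤ 1 := pow_le_one₀ (by norm_num) (by norm_num)
    simp only [hlev, pow_zero]
    nlinarith
  have hlev_le : ∀ k, lev k ≤ u := fun k => by
    have : 0 ≤ ε * S / v * (4 / 5) ^ k := by positivity
    simp only [hlev]
    linarith
  set inc : ℕ → ℝ := fun k => ε * S / v * ((4 / 5) ^ k / 5) with hinc
  have hsucc : ∀ k, lev (k + 1) = lev k + inc k := fun k => by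
    simp only [hlev, hinc]; ring
  have hV0 : v ^ 2 / 2 ≤ lev 0 ^ 2 / σ2 t := by
    rw [hlev0, mul_pow, hS2, mul_div_cancel_right₀ _ hpos.ne']
    have : v * (ε / v) = ε := by field_simp
    nlinarith [sq_nonneg (ε / v)]
  have hV0pos : 0 < lev 0 ^ 2 / σ2 t := by positivity
  have hmV : 3 * m / (lev 0 ^ 2 / σ2 t) ≤ 6 * ε := by
    rw [div_le_iff₀ hV0pos]
    nlinarith
  set G := gaussianTail (lev 0 / S) with hG
  have hG0 : 0 ≤ G := gaussianTail_nonneg _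
  set c := ε ^ 3 * Λ / 50 with hc
  have hc0 : 0 < c := by positivity
  set p : ℕ → ℝ := fun k =>
    P.real {ω | ∃ j < m * 2 ^ k, lev k < X (((j + 1 : ℕ) : ℝ) / (m * 2 ^ k : ℕ) * t) ω} with hp
  have hstep : ∀ k, p (k + 1) ≤ p k +
      13 * G * ((2 : ℝ) ^ k * Real.exp (-(c * (32 / 25) ^ k))) := fun k => by
    set b := σ2 t / (m * Λ * 2 ^ (k + 1)) with hb
    have hM : 0 < m * 2 ^ k := by positivity
    have hbσ : σ2 (t / (2 * (m * 2 ^ k : ℕ))) ≤ b := by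
      have e : t / (2 * (m * 2 ^ k : ℕ)) = (2 ^ (k + 1))⁻¹ * (t / m) := by
        push_cast; field_simp; ring
      rw [e]
      refine (h.scale_le (by positivity) (inv_le_one_of_one_le₀ (one_le_pow₀ one_le_two))
        (by positivity)).trans ?_
      rw [hb, le_div_iff₀ (by positivity)]
      calc _ = m * σ2 (t / m) * Λ := by field_simp
        _ ≤ _ := hvar
    have key := h.grid_refine_le (M := m * 2 ^ k) (y := inc k) ht.le hpos hlev0_pos
      (hlev_ge k) (by positivity) hM hbσ
    have eM : 2 * (m * 2 ^ k) = m * 2 ^ (k + 1) := by ring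
    rw [eM, ← hsucc k] at key
    refine key.trans (add_le_add le_rfl ?_)
    have h1 : 1 + 3 * ((m * 2 ^ (k + 1) : ℕ) : ℝ) / (lev 0 ^ 2 / σ2 t) ≤ 13 * 2 ^ k := by
      have e : 3 * ((m * 2 ^ (k + 1) : ℕ) : ℝ) / (lev 0 ^ 2 / σ2 t) =
          3 * m / (lev 0 ^ 2 / σ2 t) * (2 * 2 ^ k) := by push_cast; ring
      have h2k : (1 : ℝ) ≤ 2 ^ k := one_le_pow₀ one_le_two
      rw [e]
      nlinarith
    have h2 : c * (32 / 25) ^ k ≤ inc k ^ 2 / (2 * b) := by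
      have e : inc k ^ 2 / (2 * b) = ε ^ 2 * Λ * m / (25 * v ^ 2) * (32 / 25) ^ k := by
        have e32 : (32 / 25 : ℝ) ^ k = 2 ^ k * ((4 / 5) ^ k) ^ 2 := by
          rw [← pow_mul, mul_comm k 2, pow_mul, ← mul_pow]; norm_num
        rw [e32, hb, ← hS2]
        simp only [hinc]
        field_simp
        ring
      rw [e, hc]
      refine mul_le_mul_of_nonneg_right ?_ (by positivity)
      rw [div_le_div_iff₀ (by norm_num) (by positivity)]
      calc ε ^ 3 * Λ * (25 * v ^ 2) = ε ^ 2 * Λ * 25 * (ε * v ^ 2) := by ring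
        _ ≤ ε ^ 2 * Λ * 25 * (2 * m) := mul_le_mul_of_nonneg_left hm_ge (by positivity)
        _ = _ := by ring
    calc _ ≤ 13 * 2 ^ k * G * Real.exp (-(c * (32 / 25) ^ k)) := by gcongr
      _ = _ := by ring
  have hp0 : p 0 ≤ (1 + 6 * ε) * G := by
    have e : {ω | ∃ j < m * 2 ^ 0, lev 0 < X (((j + 1 : ℕ) : ℝ) / (m * 2 ^ 0 : ℕ) * t) ω} ⊆
        ⋃ j ∈ Finset.range m, {ω | lev 0 < X (((j + 1 : ℕ) : ℝ) / m * t) ω} := by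
      rintro ω ⟨j, hj, hjX⟩
      rw [pow_zero, mul_one] at hj hjX
      exact mem_biUnion (Finset.mem_coe.2 (Finset.mem_range.2 hj)) hjX
    refine (measureReal_mono e (measure_ne_top _ _)).trans ((measureReal_biUnion_finset_le _ _).trans
      ((h.sum_grid_tail_le ht.le hpos hlev0_pos hm).trans ?_))
    gcongr
  have hpn : p n ≤ (1 + 6 * ε) * G + 13 * G *
      ∑ k ∈ Finset.range n, (2 : ℝ) ^ k * Real.exp (-(c * (32 / 25) ^ k)) := by
    clear_value p
    induction n with
    | zero => simpa using hp0
    | succ k ih =>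
      rw [Finset.sum_range_succ, mul_add]
      linarith [hstep k]
  have hsum : ∑ k ∈ Finset.range n, (2 : ℝ) ^ k * Real.exp (-(c * (32 / 25) ^ k)) ≤ ε / 13 := by
    refine (sum_two_pow_mul_exp_le hc0 n).trans ?_
    rw [div_le_div_iff₀ (by positivity) (by norm_num)]
    linarith
  have hfin : p n ≤ (1 + 7 * ε) * G := by
    refine hpn.trans ((add_le_add le_rfl
      (mul_le_mul_of_nonneg_left hsum (by positivity : 0 ≤ 13 * G))).trans (le_of_eq ?_))
    ring
  have hGv : G ≤ (1 + 13 * ε) * gaussianTail v := by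
    rw [hG, hlev0, mul_div_cancel_right₀ _ hS0.ne']
    exact gaussianTail_sub_div_le (by linarith) hε.le hε1
  have hmono : P.real {ω | ∃ j < m * 2 ^ n,
      u < X (((j + 1 : ℕ) : ℝ) / (m * 2 ^ n : ℕ) * t) ω} ≤ p n :=
    measureReal_mono fun ω ⟨j, hj, hjX⟩ => ⟨j, hj, (hlev_le n).trans_lt hjX⟩
  refine hmono.trans (hfin.trans ?_)
  have hT := gaussianTail_nonneg v
  calc (1 + 7 * ε) * G ≤ (1 + 7 * ε) * ((1 + 13 * ε) * gaussianTail v) := by gcongr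
    _ = (1 + 20 * ε + 91 * (ε * ε)) * gaussianTail v := by ring
    _ ≤ _ := mul_le_mul_of_nonneg_right (by nlinarith) hT

/-- The supremum of a path over `[0, t]` exceeds `u` only slightly more often than `X t` does,
provided `u / σ(t)` is large and the variance of increments over short intervals is small. -/
lemma exceed_le (h : IsConvexGaussian P X σ2)
    (hpath : ∀ᵐ ω ∂P, ContinuousOn (fun t => X t ω) (Ici 0)) (hX0 : ∀ᵐ ω ∂P, X 0 ω = 0)
    {t u ε Λ : ℝ} (ht : 0 < t) (hpos : 0 < σ2 t)
    (hu : 0 < u) (hε : 0 < ε) (hε1 : ε ≤ 1) (hv : 4 ≤ u ^ 2 / σ2 t) {m : ℕ} (hm : 0 < m)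
    (hm_le : m ≤ ε * (u ^ 2 / σ2 t)) (hm_ge : ε * (u ^ 2 / σ2 t) ≤ 2 * m) (hΛ : 0 < Λ)
    (hvar : m * σ2 (t / m) * Λ ≤ σ2 t) (hΛε : 1248 ≤ ε * (ε ^ 3 * Λ / 50) ^ 4) :
    P.real {ω | ∃ s ∈ Icc 0 t, u < X s ω} ≤ (1 + 111 * ε) * gaussianTail (u / √(σ2 t)) := by
  set E : ℕ → Set Ω := fun n =>
    {ω | ∃ j < m * 2 ^ n, u < X (((j + 1 : ℕ) : ℝ) / (m * 2 ^ n : ℕ) * t) ω} with hE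
  have hmono : Monotone E := by
    refine monotone_nat_of_le_succ fun n ω => ?_
    rintro ⟨j, hj, hjX⟩
    refine ⟨2 * j + 1, by rw [pow_succ, ← mul_assoc]; omega, ?_⟩
    convert! hjX using 2
    push_cast
    field_simp
    ring
  have hsub : {ω | ∃ s ∈ Icc 0 t, u < X s ω} ≤ᵐ[P] ⋃ n, E n := by
    filter_upwards [hpath, hX0] with ω hω h0
    rintro ⟨s, hs, hsX⟩
    have hs0 : 0 < s := hs.1.lt_of_ne' fun h => by
      rw [h, h0] at hsX; exact absurd hsX hu.not_gt
    have hst : 0 < s / t := by positivity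
    have hN : Tendsto (fun n : ℕ => ((m * 2 ^ n : ℕ) : ℝ)) atTop atTop := by
      push_cast
      exact (tendsto_pow_atTop_atTop_of_one_lt one_lt_two).const_mul_atTop (by exact_mod_cast hm)
    have hlim := ((tendsto_nat_ceil_mul_div_atTop hst.le).comp hN).mul_const t
    rw [div_mul_cancel₀ _ ht.ne'] at hlim
    have hlim' : Tendsto (fun n : ℕ => (⌈s / t * ((m * 2 ^ n : ℕ) : ℝ)⌉₊ : ℝ) /
        ((m * 2 ^ n : ℕ) : ℝ) * t) atTop (nhdsWithin s (Ici 0)) :=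
      tendsto_nhdsWithin_iff.2 ⟨hlim, Eventually.of_forall fun n => by
        simp only [mem_Ici]; positivity⟩
    have hX := (hω s hs.1).tendsto.comp hlim'
    obtain ⟨n, hn⟩ := (hX.eventually (lt_mem_nhds hsX)).exists
    have hMpos : (0 : ℝ) < ((m * 2 ^ n : ℕ) : ℝ) := by positivity
    have hcpos : 0 < ⌈s / t * ((m * 2 ^ n : ℕ) : ℝ)⌉₊ := Nat.ceil_pos.2 (by positivity)
    refine mem_iUnion.2 ⟨n, ⌈s / t * ((m * 2 ^ n : ℕ) : ℝ)⌉₊ - 1, ?_, ?_⟩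
    · have : ⌈s / t * ((m * 2 ^ n : ℕ) : ℝ)⌉₊ ≤ m * 2 ^ n := by
        refine Nat.ceil_le.2 (mul_le_of_le_one_left hMpos.le ?_)
        rw [div_le_one ht]; exact hs.2
      omega
    · rw [Nat.sub_add_cancel hcpos]
      exact hn
  have hbound : P (⋃ n, E n) ≤
      ENNReal.ofReal ((1 + 111 * ε) * gaussianTail (u / √(σ2 t))) := by
    rw [hmono.measure_iUnion]
    refine iSup_le fun n => ?_
    rw [← ofReal_measureReal]
    exact ENNReal.ofReal_le_ofReal
      (h.dyadic_grid_le ht hpos hu hε hε1 hv hm hm_le hm_ge hΛ hvar hΛε n)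
  exact ENNReal.toReal_le_of_le_ofReal (mul_nonneg (by positivity) (gaussianTail_nonneg _))
    ((measure_mono_ae hsub).trans hbound)

end IsConvexGaussian

namespace IsConvexGaussian

variable {Ω : Type*} [MeasurableSpace Ω] {P : Measure Ω} {X : ℝ → Ω → ℝ} {σ2 : ℝ → ℝ}

lemma eventually_pos (h : IsConvexGaussian P X σ2) {αinf : ℝ}
    (hA2 : ∀ l : ℝ, 0 < l → Tendsto (fun t => σ2 (l * t) / σ2 t) atTop (nhds (l ^ αinf))) :
    ∀ᶠ t in atTop, 0 < σ2 t := by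
  have h1 := hA2 1 one_pos
  simp only [one_mul, Real.one_rpow] at h1
  filter_upwards [h1.eventually (lt_mem_nhds one_pos), eventually_ge_atTop 0] with t ht ht0
  exact (h.nonneg ht0).lt_of_ne' fun h0 => by simp [h0] at ht

/-- The supremum over `[0, t]` exceeds `u` at most `1 + 111 ε` times as often as `X t`, uniformly
over large `t` and large `u / σ(t)`. -/
lemma exists_forall_exceed_le [IsProbabilityMeasure P] (h : IsConvexGaussian P X σ2)
    (hpath : ∀ᵐ ω ∂P, ContinuousOn (fun t => X t ω) (Ici 0)) (hX0 : ∀ᵐ ω ∂P, X 0 ω = 0)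
    {αinf : ℝ} (hα : 1 < αinf)
    (hA2 : ∀ l : ℝ, 0 < l → Tendsto (fun t => σ2 (l * t) / σ2 t) atTop (nhds (l ^ αinf)))
    {ε : ℝ} (hε : 0 < ε) (hε1 : ε ≤ 1) :
    ∃ t₀ > 0, ∃ κ > 0, 0 < σ2 t₀ ∧ ∀ t ≥ t₀, ∀ u > 0, κ * σ2 t ≤ u ^ 2 →
      P.real {ω | ∃ s ∈ Icc 0 t, u < X s ω} ≤ (1 + 111 * ε) * gaussianTail (u / √(σ2 t)) := by
  obtain ⟨Λ, hΛ, hΛε⟩ : ∃ Λ : ℝ, 0 < Λ ∧ 1248 ≤ ε * (ε ^ 3 * Λ / 50) ^ 4 := by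
    refine ⟨50 * (1248 / ε) / ε ^ 3, by positivity, ?_⟩
    have h1 : ε ^ 3 * (50 * (1248 / ε) / ε ^ 3) / 50 = 1248 / ε := by field_simp
    have h2 : 1 ≤ 1248 / ε := by rw [le_div_iff₀ hε]; linarith
    rw [h1]
    calc (1248 : ℝ) = ε * (1248 / ε) := by field_simp
      _ ≤ _ := by gcongr; exact le_self_pow₀ h2 (by norm_num)
  obtain ⟨m₀, hm₀, hm₀Λ⟩ : ∃ m₀ : ℕ, 0 < m₀ ∧ ((1 / m₀ : ℝ) ^ αinf) * (m₀ * Λ) < 1 := by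
    have h1 : Tendsto (fun n : ℕ => (n : ℝ) ^ (-(αinf - 1)) * Λ) atTop (nhds (0 * Λ)) :=
      ((tendsto_rpow_neg_atTop (by linarith)).comp tendsto_natCast_atTop_atTop).mul_const Λ
    rw [zero_mul] at h1
    obtain ⟨n, hn, hn0⟩ := ((h1.eventually (gt_mem_nhds one_pos)).and
      (eventually_gt_atTop 0)).exists
    refine ⟨n, hn0, lt_of_eq_of_lt ?_ hn⟩
    have hn' : (0 : ℝ) < n := by exact_mod_cast hn0
    rw [one_div, Real.inv_rpow hn'.le, ← Real.rpow_neg hn'.le, ← mul_assoc, neg_sub, sub_eq_neg_add,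
      Real.rpow_add_one hn'.ne']
  have hm₀' : (0 : ℝ) < m₀ := by exact_mod_cast hm₀
  have hev : ∀ᶠ t in atTop, 0 < t ∧ 0 < σ2 t ∧ m₀ * σ2 (1 / m₀ * t) * Λ ≤ σ2 t := by
    have h1 := ((hA2 (1 / m₀) (by positivity)).mul_const (m₀ * Λ)).eventually
      (gt_mem_nhds hm₀Λ)
    filter_upwards [h1, h.eventually_pos hA2, eventually_gt_atTop 0] with t ht hσ ht0
    refine ⟨ht0, hσ, ?_⟩
    rw [div_mul_eq_mul_div, div_lt_one hσ] at ht
    linarith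
  obtain ⟨t₀, ht₀⟩ := eventually_atTop.1 hev
  refine ⟨t₀, (ht₀ t₀ le_rfl).1, max 4 (m₀ / ε), by positivity, (ht₀ t₀ le_rfl).2.1,
    fun t ht u hu hκ => ?_⟩
  obtain ⟨htpos, hσ, hvar⟩ := ht₀ t ht
  have hV : max 4 (m₀ / ε) ≤ u ^ 2 / σ2 t := (le_div_iff₀ hσ).2 hκ
  have hVm : (m₀ : ℝ) ≤ ε * (u ^ 2 / σ2 t) := by
    have := (le_max_right _ _).trans hV
    rwa [div_le_iff₀' hε] at this
  set m := ⌊ε * (u ^ 2 / σ2 t)⌋₊ with hm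
  have hmm : m₀ ≤ m := Nat.le_floor hVm
  have hmm' : (m₀ : ℝ) ≤ m := by exact_mod_cast hmm
  have hmpos : (0 : ℝ) < m := hm₀'.trans_le hmm'
  have hm1 : (1 : ℝ) ≤ m := by exact_mod_cast hm₀.trans_le hmm
  refine h.exceed_le hpath hX0 htpos hσ hu hε hε1 ((le_max_left _ _).trans hV)
    (hm₀.trans_le hmm) (Nat.floor_le (by positivity)) ?_ hΛ ?_ hΛε
  · have := Nat.lt_floor_add_one (ε * (u ^ 2 / σ2 t))
    rw [← hm] at this
    linarith
  · have h1 := h.scale_le (x := m₀ / m) (t := 1 / m₀ * t) (by positivity)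
      ((div_le_one hmpos).2 hmm') (by positivity)
    have h2 : (m₀ : ℝ) / m * (1 / m₀ * t) = t / m := by field_simp
    rw [h2] at h1
    calc m * σ2 (t / m) * Λ ≤ m * (m₀ / m * σ2 (1 / m₀ * t)) * Λ := by gcongr
      _ = m₀ * σ2 (1 / m₀ * t) * Λ := by field_simp
      _ ≤ σ2 t := hvar

end IsConvexGaussian

section

variable {Ω : Type*}

/-- The values of a process at the nonnegative rationals. -/
def rationalSkeleton (X : ℝ → Ω → ℝ) (ω : Ω) (q : ℚ) : ℝ := X |(q : ℝ)| ω

lemma rationalSkeleton_of_nonneg (X : ℝ → Ω → ℝ) (ω : Ω) {q : ℚ} (hq : 0 ≤ q) :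
    rationalSkeleton X ω q = X q ω := by
  rw [rationalSkeleton, abs_of_nonneg (by exact_mod_cast hq)]

variable [MeasurableSpace Ω] {P : Measure Ω}

lemma measure_pair_mem_eq_lintegral [IsProbabilityMeasure P] {β : Type*} [MeasurableSpace β] {T : Ω → ℝ} {g : Ω → β}
    (hT : Measurable T) (hg : Measurable g) (hTg : IndepFun T g P) {A : Set (ℝ × β)}
    (hA : MeasurableSet A) :
    P {ω | (T ω, g ω) ∈ A} = ∫⁻ t, P {ω | (t, g ω) ∈ A} ∂P.map T := by
  have := Measure.isProbabilityMeasure_map (μ := P) hg.aemeasurable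
  have h1 := (indepFun_iff_map_prod_eq_prod_map_map hT.aemeasurable hg.aemeasurable).1 hTg
  have h2 : P {ω | (T ω, g ω) ∈ A} = P.map (fun ω => (T ω, g ω)) A :=
    (Measure.map_apply (hT.prodMk hg) hA).symm
  rw [h2, h1, Measure.prod_apply hA]
  refine lintegral_congr fun t => ?_
  rw [Measure.map_apply hg (measurable_prodMk_left hA)]
  rfl

lemma measurable_rationalSkeleton {X : ℝ → Ω → ℝ} (hX : ∀ t, Measurable (X t)) :
    Measurable (rationalSkeleton X) :=
  measurable_pi_lambda _ fun q => hX |(q : ℝ)|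

lemma indepFun_rationalSkeleton {X : ℝ → Ω → ℝ} {T : Ω → ℝ}
    (hInd : Indep (MeasurableSpace.comap T inferInstance)
      (⨆ t ∈ Ici (0 : ℝ), MeasurableSpace.comap (X t) inferInstance) P) :
    IndepFun T (rationalSkeleton X) P := by
  rw [IndepFun_iff_Indep]
  refine indep_of_indep_of_le_right hInd (Measurable.comap_le ?_)
  refine @measurable_pi_lambda _ _ _ (_) _ _ fun q => Measurable.of_comap_le ?_
  exact le_iSup₂_of_le |(q : ℝ)| (mem_Ici.2 (abs_nonneg _)) le_rfl

lemma exists_rat_exceed {f : ℝ → ℝ} (hf : ContinuousOn f (Ici 0)) (hf0 : f 0 = 0) {s u : ℝ}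
    (hs : 0 ≤ s) (hu : 0 ≤ u) (hus : u < f s) : ∃ q : ℚ, 0 ≤ q ∧ (q : ℝ) ≤ s ∧ u < f q := by
  have hs0 : 0 < s := hs.lt_of_ne fun h => by rw [← h, hf0] at hus; linarith
  have hc : ContinuousAt f s := hf.continuousAt (Ici_mem_nhds hs0)
  obtain ⟨a, ha, hac⟩ := (mem_nhdsLE_iff_exists_Ioc_subset).1
    (mem_nhdsWithin_of_mem_nhds (hc.eventually (lt_mem_nhds hus)))
  obtain ⟨q, hq1, hq2⟩ := exists_rat_btwn (max_lt ha hs0)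
  rw [max_lt_iff] at hq1
  exact ⟨q, by exact_mod_cast hq1.2.le, hq2.le, hac ⟨hq1.1, hq2.le⟩⟩

lemma lt_iff_exists_rat_forall_near {f : ℝ → ℝ} (hf : ContinuousOn f (Ici 0)) {t u : ℝ}
    (ht : 0 ≤ t) : u < f t ↔ ∃ r : ℚ, u < r ∧ ∃ δ : ℚ, 0 < δ ∧ ∀ q : ℚ, 0 ≤ q →
      |(q : ℝ) - t| < δ → (r : ℝ) ≤ f q := by
  have hc := Metric.continuousWithinAt_iff.1 (hf t ht)
  constructor
  · intro hu
    obtain ⟨r, hr1, hr2⟩ := exists_rat_btwn hu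
    obtain ⟨δ, hδ, hδf⟩ := hc (f t - r) (by linarith)
    obtain ⟨δ', hδ1, hδ2⟩ := exists_rat_btwn hδ
    refine ⟨r, hr1, δ', by exact_mod_cast hδ1, fun q hq hqt => ?_⟩
    have := hδf (x := (q : ℝ)) (mem_Ici.2 (by exact_mod_cast hq)) (by rw [Real.dist_eq]; linarith)
    rw [Real.dist_eq, abs_lt] at this
    linarith
  · rintro ⟨r, hr, δ, hδ, H⟩
    by_contra! hle
    obtain ⟨δ', hδ', hδf⟩ := hc (r - f t) (by linarith)
    have hδ0 : (0 : ℝ) < δ := by exact_mod_cast hδ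
    obtain ⟨q, hq1, hq2⟩ := exists_rat_btwn (show t < t + min (δ : ℝ) δ' by
      linarith [lt_min hδ0 hδ'])
    have hq0 : (0 : ℝ) ≤ q := by linarith
    have habs : |(q : ℝ) - t| < min (δ : ℝ) δ' := by rw [abs_of_pos] <;> linarith
    have h1 := H q (by exact_mod_cast hq0) (habs.trans_le (min_le_left _ _))
    have h2 := hδf (x := (q : ℝ)) hq0 (by
      rw [Real.dist_eq]; exact habs.trans_le (min_le_right _ _))
    rw [Real.dist_eq, abs_lt] at h2
    linarith

variable {X : ℝ → Ω → ℝ} {T : Ω → ℝ}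

lemma ae_map_nonneg (hTm : Measurable T) (hTnn : ∀ ω, 0 ≤ T ω) : ∀ᵐ t ∂P.map T, 0 ≤ t :=
  (ae_map_iff hTm.aemeasurable measurableSet_Ici).2 (ae_of_all _ hTnn)

variable [IsProbabilityMeasure P]

lemma measure_sup_exceed_le_lintegral (hX : ∀ t, Measurable (X t))
    (hpath : ∀ᵐ ω ∂P, ContinuousOn (fun t => X t ω) (Ici 0)) (hX0 : ∀ᵐ ω ∂P, X 0 ω = 0)
    (hTm : Measurable T) (hTnn : ∀ ω, 0 ≤ T ω)
    (hInd : Indep (MeasurableSpace.comap T inferInstance)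
      (⨆ t ∈ Ici (0 : ℝ), MeasurableSpace.comap (X t) inferInstance) P) {u : ℝ} (hu : 0 ≤ u) :
    P {ω | u < sSup ((fun s => X s ω) '' Icc 0 (T ω))} ≤
      ∫⁻ t, P {ω | ∃ s ∈ Icc 0 t, u < X s ω} ∂P.map T := by
  set A : Set (ℝ × (ℚ → ℝ)) := {x | ∃ q : ℚ, 0 ≤ q ∧ (q : ℝ) ≤ x.1 ∧ u < x.2 q} with hA
  have hAm : MeasurableSet A := by
    simp only [hA, ofPred_exists]
    refine MeasurableSet.iUnion fun q => (MeasurableSet.const _).inter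
      ((measurableSet_le measurable_const measurable_fst).inter
        (measurableSet_lt measurable_const ((measurable_pi_apply q).comp measurable_snd)))
  calc P {ω | u < sSup ((fun s => X s ω) '' Icc 0 (T ω))}
      ≤ P {ω | (T ω, rationalSkeleton X ω) ∈ A} := by
        refine measure_mono_ae ?_
        filter_upwards [hpath, hX0] with ω hω h0 hsup
        obtain ⟨-, ⟨s, hs, rfl⟩, hus⟩ := exists_lt_of_lt_csSup
          (Nonempty.image _ (nonempty_Icc.2 (hTnn ω))) hsup
        obtain ⟨q, hq0, hqs, hq⟩ := exists_rat_exceed hω h0 hs.1 hu hus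
        exact ⟨q, hq0, hqs.trans hs.2, by simpa [rationalSkeleton_of_nonneg X ω hq0] using hq⟩
    _ = ∫⁻ t, P {ω | (t, rationalSkeleton X ω) ∈ A} ∂P.map T :=
        measure_pair_mem_eq_lintegral hTm (measurable_rationalSkeleton hX)
          (indepFun_rationalSkeleton hInd) hAm
    _ ≤ _ := by
        refine lintegral_mono fun t => measure_mono ?_
        rintro ω ⟨q, hq0, hqt, hq⟩
        exact ⟨q, ⟨by exact_mod_cast hq0, hqt⟩, (rationalSkeleton_of_nonneg X ω hq0) ▸ hq⟩

lemma measure_exceed_at_time_eq_lintegral (hX : ∀ t, Measurable (X t))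
    (hpath : ∀ᵐ ω ∂P, ContinuousOn (fun t => X t ω) (Ici 0))
    (hTm : Measurable T) (hTnn : ∀ ω, 0 ≤ T ω)
    (hInd : Indep (MeasurableSpace.comap T inferInstance)
      (⨆ t ∈ Ici (0 : ℝ), MeasurableSpace.comap (X t) inferInstance) P) (u : ℝ) :
    P {ω | u < X (T ω) ω} = ∫⁻ t, P {ω | u < X t ω} ∂P.map T := by
  set A : Set (ℝ × (ℚ → ℝ)) := {x | ∃ r : ℚ, u < r ∧ ∃ δ : ℚ, 0 < δ ∧ ∀ q : ℚ, 0 ≤ q →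
      |(q : ℝ) - x.1| < δ → (r : ℝ) ≤ x.2 q} with hA
  have hAm : MeasurableSet A := by
    simp only [hA, ofPred_exists, ofPred_and, ofPred_forall]
    refine MeasurableSet.iUnion fun r => (MeasurableSet.const _).inter
      (MeasurableSet.iUnion fun δ => (MeasurableSet.const _).inter
        (MeasurableSet.iInter fun q => MeasurableSet.iInter fun _ => ?_))
    simp only [imp_iff_not_or, ofPred_or]
    refine MeasurableSet.union ?_ ?_
    · exact (measurableSet_lt (f := fun x : ℝ × (ℚ → ℝ) => |(q : ℝ) - x.1|) (by fun_prop)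
        measurable_const).compl
    · exact measurableSet_le measurable_const ((measurable_pi_apply q).comp measurable_snd)
  have hiff : ∀ ω, ContinuousOn (fun t => X t ω) (Ici 0) → ∀ t, 0 ≤ t →
      (u < X t ω ↔ (t, rationalSkeleton X ω) ∈ A) := by
    intro ω hω t ht
    rw [lt_iff_exists_rat_forall_near hω ht]
    refine exists_congr fun r => and_congr_right fun _ => exists_congr fun δ =>
      and_congr_right fun _ => forall_congr' fun q => forall_congr' fun hq => ?_
    simp only [rationalSkeleton_of_nonneg X ω hq]
  calc P {ω | u < X (T ω) ω} = P {ω | (T ω, rationalSkeleton X ω) ∈ A} := by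
        refine measure_congr ?_
        filter_upwards [hpath] with ω hω
        exact propext (hiff ω hω _ (hTnn ω))
    _ = ∫⁻ t, P {ω | (t, rationalSkeleton X ω) ∈ A} ∂P.map T :=
        measure_pair_mem_eq_lintegral hTm (measurable_rationalSkeleton hX)
          (indepFun_rationalSkeleton hInd) hAm
    _ = _ := by
        refine lintegral_congr_ae ?_
        filter_upwards [ae_map_nonneg hTm hTnn] with t ht
        refine measure_congr ?_
        filter_upwards [hpath] with ω hω
        exact propext (hiff ω hω _ ht).symm

/-- `X(T)` and `σ(T) N` have the same tails. -/
lemma IsConvexGaussian.measure_exceed_eq_measure_sqrt_mul {σ2 : ℝ → ℝ}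
    (h : IsConvexGaussian P X σ2)
    (hpath : ∀ᵐ ω ∂P, ContinuousOn (fun t => X t ω) (Ici 0))
    (hTm : Measurable T) (hTnn : ∀ ω, 0 ≤ T ω)
    (hInd : Indep (MeasurableSpace.comap T inferInstance)
      (⨆ t ∈ Ici (0 : ℝ), MeasurableSpace.comap (X t) inferInstance) P)
    {N : Ω → ℝ} (hNm : Measurable N) (hNlaw : P.map N = gaussianReal 0 1)
    (hNT : IndepFun T N P) {u : ℝ} (hu : 0 ≤ u) :
    P {ω | u < X (T ω) ω} = P {ω | u < √(σ2 (T ω)) * N ω} := by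
  have hσm : Measurable fun t => σ2 (max t 0) :=
    Monotone.measurable fun s t hst => h.mono (le_max_right _ _) (max_le_max_right 0 hst)
  have hAm : MeasurableSet {x : ℝ × ℝ | u < √(σ2 (max x.1 0)) * x.2} :=
    measurableSet_lt measurable_const ((hσm.comp measurable_fst).sqrt.mul measurable_snd)
  have h1 := measure_pair_mem_eq_lintegral hTm hNm hNT hAm
  simp only [mem_ofPred_eq, max_eq_left (hTnn _)] at h1
  rw [h1, measure_exceed_at_time_eq_lintegral h.measurable hpath hTm hTnn hInd]
  refine lintegral_congr_ae ?_
  filter_upwards [ae_map_nonneg hTm hTnn] with t ht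
  rw [max_eq_left ht, ← measureReal_eq_measureReal_iff]
  rcases (h.nonneg ht).eq_or_lt' with h0 | hpos
  · rw [h.tail_eq_zero ht h0 hu]
    simp [h0, hu.not_gt]
  · have hs : 0 < √(σ2 t) := Real.sqrt_pos.2 hpos
    rw [h.tail_eq ht hpos, gaussianTail, ← hNlaw, map_measureReal_apply hNm measurableSet_Ioi]
    congr 1
    ext ω
    simp only [mem_preimage, mem_Ioi, mem_ofPred_eq]
    rw [div_lt_iff₀' hs]

end

section

variable {Ω : Type*} [MeasurableSpace Ω] {P : Measure Ω} [IsProbabilityMeasure P]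
  {X : ℝ → Ω → ℝ} {T : Ω → ℝ}

lemma measureReal_sup_exceed_le (hX : ∀ t, Measurable (X t))
    (hpath : ∀ᵐ ω ∂P, ContinuousOn (fun t => X t ω) (Ici 0)) (hX0 : ∀ᵐ ω ∂P, X 0 ω = 0)
    (hTm : Measurable T) (hTnn : ∀ ω, 0 ≤ T ω)
    (hInd : Indep (MeasurableSpace.comap T inferInstance)
      (⨆ t ∈ Ici (0 : ℝ), MeasurableSpace.comap (X t) inferInstance) P) {u a b τ : ℝ}
    (hu : 0 ≤ u) (ha : 0 ≤ a) (hb : 0 ≤ b)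
    (H : ∀ t, 0 ≤ t → t ≤ τ →
      P.real {ω | ∃ s ∈ Icc 0 t, u < X s ω} ≤ a + b * P.real {ω | u < X t ω}) :
    P.real {ω | u < sSup ((fun s => X s ω) '' Icc 0 (T ω))} ≤
      a + b * P.real {ω | u < X (T ω) ω} + P.real {ω | τ < T ω} := by
  have := Measure.isProbabilityMeasure_map (μ := P) hTm.aemeasurable
  have h1 : P {ω | u < sSup ((fun s => X s ω) '' Icc 0 (T ω))} ≤
      ENNReal.ofReal a + ENNReal.ofReal b * P {ω | u < X (T ω) ω} + P {ω | τ < T ω} := by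
    calc _ ≤ ∫⁻ t, P {ω | ∃ s ∈ Icc 0 t, u < X s ω} ∂P.map T :=
          measure_sup_exceed_le_lintegral hX hpath hX0 hTm hTnn hInd hu
      _ ≤ ∫⁻ t, (ENNReal.ofReal a + ENNReal.ofReal b * P {ω | u < X t ω} +
            (Ioi τ).indicator 1 t) ∂P.map T := by
          refine lintegral_mono_ae ?_
          filter_upwards [ae_map_nonneg hTm hTnn] with t ht
          rcases le_or_gt t τ with hτ | hτ
          · refine le_add_right ?_
            rw [← ofReal_measureReal, ← ofReal_measureReal (s := {ω | u < X t ω}),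
              ← ENNReal.ofReal_mul hb, ← ENNReal.ofReal_add ha (by positivity)]
            exact ENNReal.ofReal_le_ofReal (H t ht hτ)
          · refine le_add_left ?_
            rw [indicator_of_mem (mem_Ioi.2 hτ)]
            exact prob_le_one
      _ = _ := by
          rw [lintegral_add_right _ (measurable_one.indicator measurableSet_Ioi),
            lintegral_add_left measurable_const, lintegral_const_mul' _ _ ENNReal.ofReal_ne_top,
            lintegral_const, measure_univ, mul_one, lintegral_indicator_one measurableSet_Ioi,
            Measure.map_apply hTm measurableSet_Ioi,
            measure_exceed_at_time_eq_lintegral hX hpath hTm hTnn hInd]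
          rfl
  rw [← ofReal_measureReal (s := {ω | u < X (T ω) ω}), ← ofReal_measureReal (s := {ω | τ < T ω}),
    ← ENNReal.ofReal_mul hb, ← ENNReal.ofReal_add ha (by positivity),
    ← ENNReal.ofReal_add (by positivity) (by positivity)] at h1
  exact ENNReal.toReal_le_of_le_ofReal (by positivity) h1

lemma mul_le_measureReal_exceed_at_time (hX : ∀ t, Measurable (X t))
    (hpath : ∀ᵐ ω ∂P, ContinuousOn (fun t => X t ω) (Ici 0))
    (hTm : Measurable T) (hTnn : ∀ ω, 0 ≤ T ω)
    (hInd : Indep (MeasurableSpace.comap T inferInstance)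
      (⨆ t ∈ Ici (0 : ℝ), MeasurableSpace.comap (X t) inferInstance) P) {u c s : ℝ} (hc : 0 ≤ c)
    (H : ∀ t > s, c ≤ P.real {ω | u < X t ω}) :
    c * P.real {ω | s < T ω} ≤ P.real {ω | u < X (T ω) ω} := by
  have h1 : ENNReal.ofReal c * P {ω | s < T ω} ≤ P {ω | u < X (T ω) ω} := by
    rw [measure_exceed_at_time_eq_lintegral hX hpath hTm hTnn hInd]
    calc _ = ∫⁻ t, (Ioi s).indicator (fun _ => ENNReal.ofReal c) t ∂P.map T := by
          rw [lintegral_indicator_const measurableSet_Ioi, Measure.map_apply hTm measurableSet_Ioi]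
          rfl
      _ ≤ _ := by
          refine lintegral_mono (indicator_le fun t ht => ?_)
          rw [← ofReal_measureReal]
          exact ENNReal.ofReal_le_ofReal (H t ht)
  rw [← ofReal_measureReal, ← ofReal_measureReal (s := {ω | u < X (T ω) ω}),
    ← ENNReal.ofReal_mul hc] at h1
  exact (ENNReal.ofReal_le_ofReal_iff (by positivity)).1 h1

lemma measure_exceed_at_time_le_sup
    (hpath : ∀ᵐ ω ∂P, ContinuousOn (fun t => X t ω) (Ici 0)) (hTnn : ∀ ω, 0 ≤ T ω) (u : ℝ) :
    P.real {ω | u < X (T ω) ω} ≤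
      P.real {ω | u < sSup ((fun s => X s ω) '' Icc 0 (T ω))} := by
  refine ENNReal.toReal_mono (measure_ne_top _ _) (measure_mono_ae ?_)
  filter_upwards [hpath] with ω hω hu
  have hu : u < X (T ω) ω := hu
  exact hu.trans_le (le_csSup
    (isCompact_Icc.image_of_continuousOn (hω.mono Icc_subset_Ici_self)).bddAbove
    (mem_image_of_mem _ (right_mem_Icc.2 (hTnn ω))))

end

section

variable {Ω : Type*} [MeasurableSpace Ω] {P : Measure Ω} {X : ℝ → Ω → ℝ} {T : Ω → ℝ}

lemma MemW.measureReal_pos [IsFiniteMeasure P] {α β γ C : ℝ} (hTW : MemW P T α β γ C) (t : ℝ) :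
    0 < P.real {ω | t < T ω} := by
  obtain ⟨s, hs, hts⟩ := ((Tendsto.eventually hTW (lt_mem_nhds one_pos)).and
    (eventually_ge_atTop t)).exists
  have h1 : 0 < P.real {ω | s < T ω} :=
    measureReal_nonneg.lt_of_ne' fun h0 => by
      rw [Measure.real] at h0
      simp [h0] at hs
  exact h1.trans_le (measureReal_mono fun ω hω => hts.trans_lt hω)

/-- Asymptotically Weibullian tails are rapidly varying. -/
lemma MemW.eventually_le_mul_half {α β γ C : ℝ} (hα : 0 < α) (hβ : 0 < β) (hC : 0 < C)
    (hTW : MemW P T α β γ C) {η : ℝ} (hη : 0 < η) :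
    ∀ᶠ τ in atTop, P.real {ω | τ < T ω} ≤ η * P.real {ω | τ / 2 < T ω} := by
  set w : ℝ → ℝ := fun t => C * t ^ γ * Real.exp (-β * t ^ α) with hw
  have hup : ∀ᶠ τ in atTop, P.real {ω | τ < T ω} ≤ 2 * w τ := by
    filter_upwards [Tendsto.eventually hTW (gt_mem_nhds one_lt_two), eventually_gt_atTop 0]
      with t ht ht0
    exact ((div_lt_iff₀ (by positivity)).1 ht).le
  have hlow : ∀ᶠ τ in atTop, 1 / 2 * w τ ≤ P.real {ω | τ < T ω} := by
    filter_upwards [Tendsto.eventually hTW (lt_mem_nhds one_half_lt_one), eventually_gt_atTop 0]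
      with t ht ht0
    exact ((lt_div_iff₀ (by positivity)).1 ht).le
  set b := β * (1 - (1 / 2) ^ α) with hb
  have hb0 : 0 < b := mul_pos hβ (sub_pos.2 (Real.rpow_lt_one (by norm_num) (by norm_num) hα))
  have hratio : ∀ t : ℝ, 0 < t → w t = 2 ^ γ * Real.exp (-(b * t ^ α)) * w (t / 2) := by
    intro t ht
    have h1 : t ^ γ = 2 ^ γ * (t / 2) ^ γ := by
      rw [← Real.mul_rpow (by norm_num) (by positivity)]
      congr 1
      ring
    have h2 : (t / 2) ^ α = (1 / 2) ^ α * t ^ α := by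
      rw [← Real.mul_rpow (by norm_num) ht.le]
      congr 1
      ring
    have h3 : Real.exp (-β * t ^ α) = Real.exp (-(b * t ^ α)) * Real.exp (-β * (t / 2) ^ α) := by
      rw [← Real.exp_add, h2, hb]
      congr 1
      ring
    simp only [hw]
    rw [h1, h3]
    ring
  have hlim : Tendsto (fun t : ℝ => 4 * 2 ^ γ * Real.exp (-(b * t ^ α))) atTop (nhds 0) := by
    rw [← mul_zero (4 * (2 : ℝ) ^ γ)]
    exact (Real.tendsto_exp_neg_atTop_nhds_zero.comp
      ((tendsto_rpow_atTop hα).const_mul_atTop hb0)).const_mul _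
  have hhalf : Tendsto (fun t : ℝ => t / 2) atTop atTop := tendsto_id.atTop_div_const two_pos
  filter_upwards [hup, hhalf.eventually hlow, hlim.eventually (gt_mem_nhds hη),
    eventually_gt_atTop 0] with t h1 h2 h3 ht
  have hw0 : 0 < w (t / 2) := by positivity
  calc P.real {ω | t < T ω} ≤ 2 * w t := h1
    _ = 4 * 2 ^ γ * Real.exp (-(b * t ^ α)) * (1 / 2 * w (t / 2)) := by rw [hratio t ht]; ring
    _ ≤ η * P.real {ω | t / 2 < T ω} := by gcongr

namespace IsConvexGaussian

variable {σ2 : ℝ → ℝ}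

lemma tendsto_atTop (h : IsConvexGaussian P X σ2) {t₀ : ℝ} (ht₀ : 0 < t₀) (hpos : 0 < σ2 t₀) :
    Tendsto σ2 atTop atTop := by
  refine tendsto_atTop_mono' _ ?_ (tendsto_id.const_mul_atTop (div_pos hpos ht₀))
  filter_upwards [eventually_ge_atTop t₀] with t ht
  have ht0 := ht₀.trans_le ht
  have := h.scale_le (x := t₀ / t) (by positivity) ((div_le_one ht0).2 ht) ht0.le
  rw [div_mul_cancel₀ _ ht0.ne', div_mul_eq_mul_div, le_div_iff₀ ht0] at this
  rw [id, div_mul_eq_mul_div, div_le_iff₀ ht₀]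
  linarith

lemma eventually_sup_exceed_le [IsProbabilityMeasure P] (h : IsConvexGaussian P X σ2)
    (hpath : ∀ᵐ ω ∂P, ContinuousOn (fun t => X t ω) (Ici 0)) (hX0 : ∀ᵐ ω ∂P, X 0 ω = 0)
    (hσ : ContinuousOn σ2 (Ici 0)) {αinf : ℝ} (hα : 1 < αinf) (hα2 : αinf < 2)
    (hA2 : ∀ l : ℝ, 0 < l → Tendsto (fun t => σ2 (l * t) / σ2 t) atTop (nhds (l ^ αinf)))
    (hTm : Measurable T) (hTnn : ∀ ω, 0 ≤ T ω)
    (hInd : Indep (MeasurableSpace.comap T inferInstance)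
      (⨆ t ∈ Ici (0 : ℝ), MeasurableSpace.comap (X t) inferInstance) P)
    (hTpos : ∀ t, 0 < P.real {ω | t < T ω})
    (hThalf : ∀ η > 0, ∀ᶠ τ in atTop, P.real {ω | τ < T ω} ≤ η * P.real {ω | τ / 2 < T ω})
    {ε : ℝ} (hε : 0 < ε) (hε1 : ε ≤ 1) :
    ∀ᶠ u in atTop, 0 < P.real {ω | u < X (T ω) ω} ∧
      P.real {ω | u < sSup ((fun s => X s ω) '' Icc 0 (T ω))} ≤
        (1 + 113 * ε) * P.real {ω | u < X (T ω) ω} := by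
  obtain ⟨t₀, ht₀, κ, hκ, hpos, hq⟩ := h.exists_forall_exceed_le hpath hX0 hα hA2 hε hε1
  have hpos2 : 0 < σ2 (2 * t₀) := hpos.trans_le (h.mono ht₀.le (by linarith))
  set c₀ := gaussianTail √(8 * κ) with hc₀
  have hc₀pos : 0 < c₀ := gaussianTail_pos _
  have hfar : ∀ᶠ τ in atTop, P.real {ω | τ < T ω} ≤ ε * c₀ * P.real {ω | τ / 2 < T ω} ∧
      σ2 τ ≤ 8 * σ2 (τ / 2) := by
    have h1 : (1 / 8 : ℝ) < (1 / 2) ^ αinf := by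
      calc (1 / 8 : ℝ) < (1 / 2) ^ (2 : ℝ) := by norm_num
        _ < _ := Real.rpow_lt_rpow_of_exponent_gt (by norm_num) (by norm_num) hα2
    filter_upwards [hThalf (ε * c₀) (by positivity),
      (hA2 (1 / 2) (by norm_num)).eventually (lt_mem_nhds h1), h.eventually_pos hA2]
      with τ h2 h3 h4
    rw [lt_div_iff₀ h4, show 1 / 2 * τ = τ / 2 by ring] at h3
    exact ⟨h2, by linarith⟩
  obtain ⟨M, hM⟩ := eventually_atTop.1 hfar
  have hsq : Tendsto (fun u : ℝ => u ^ 2) atTop atTop := tendsto_pow_atTop two_ne_zero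
  have hexp : Tendsto (fun u : ℝ => (1 + 111 * ε) * Real.exp (-(u ^ 2 / σ2 (2 * t₀) / 6)))
      atTop (nhds 0) := by
    rw [← mul_zero (1 + 111 * ε)]
    exact (Real.tendsto_exp_neg_atTop_nhds_zero.comp
      ((hsq.atTop_div_const hpos2).atTop_div_const (by norm_num))).const_mul _
  filter_upwards [eventually_gt_atTop 0, hsq.eventually_ge_atTop (κ * σ2 (max M t₀)),
    hexp.eventually (gt_mem_nhds (mul_pos hε (hTpos (2 * t₀))))] with u hu hMu hu2
  set F := P.real {ω | u < X (T ω) ω} with hF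
  have hFlow : gaussianTail (u / √(σ2 (2 * t₀))) * P.real {ω | 2 * t₀ < T ω} ≤ F := by
    refine mul_le_measureReal_exceed_at_time h.measurable hpath hTm hTnn hInd
      (gaussianTail_nonneg _) fun t ht => ?_
    have hmono := h.mono (by positivity) (mem_Ioi.1 ht).le
    rw [h.tail_eq (by linarith) (hpos2.trans_le hmono)]
    exact gaussianTail_antitone (by gcongr)
  have hFpos : 0 < F := (mul_pos (gaussianTail_pos _) (hTpos _)).trans_le hFlow
  refine ⟨hFpos, ?_⟩
  obtain ⟨τ, hτ, hτu⟩ : ∃ τ ≥ max M t₀, κ * σ2 τ = u ^ 2 := by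
    obtain ⟨τ', hτ', hτ'M⟩ := ((((h.tendsto_atTop ht₀ hpos).const_mul_atTop hκ).eventually_ge_atTop
      (u ^ 2)).and (eventually_ge_atTop (max M t₀))).exists
    have hcont : ContinuousOn (fun t => κ * σ2 t) (Icc (max M t₀) τ') :=
      (hσ.mono fun t ht => ht₀.le.trans ((le_max_right _ _).trans ht.1)).const_mul κ
    obtain ⟨τ, hτ, hτu⟩ := intermediate_value_Icc hτ'M hcont ⟨hMu, hτ'⟩
    exact ⟨τ, hτ.1, hτu⟩
  have hτ₀ : t₀ ≤ τ := (le_max_right _ _).trans hτ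
  obtain ⟨hTτ, hστ⟩ := hM τ ((le_max_left _ _).trans hτ)
  set a := (1 + 111 * ε) * gaussianTail (u / √(σ2 t₀)) with ha
  have ha0 : 0 ≤ a := mul_nonneg (by positivity) (gaussianTail_nonneg _)
  have hnear : a ≤ ε * F := by
    have h1 := h.tail_scale_le (x := 1 / 2) (t := 2 * t₀) (u := u) (by norm_num) (by norm_num)
      (by positivity) hpos2 hu.le
    rw [show 1 / 2 * (2 * t₀) = t₀ by ring, h.tail_eq ht₀.le hpos,
      show u ^ 2 / σ2 (2 * t₀) * (1 - 1 / 2) / 3 = u ^ 2 / σ2 (2 * t₀) / 6 by ring] at h1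
    have hG := gaussianTail_nonneg (u / √(σ2 (2 * t₀)))
    calc a ≤ (1 + 111 * ε) * (Real.exp (-(u ^ 2 / σ2 (2 * t₀) / 6)) *
          gaussianTail (u / √(σ2 (2 * t₀)))) :=
        mul_le_mul_of_nonneg_left h1 (by positivity)
      _ = (1 + 111 * ε) * Real.exp (-(u ^ 2 / σ2 (2 * t₀) / 6)) *
          gaussianTail (u / √(σ2 (2 * t₀))) := by ring
      _ ≤ ε * P.real {ω | 2 * t₀ < T ω} * gaussianTail (u / √(σ2 (2 * t₀))) := by gcongr
      _ = ε * (gaussianTail (u / √(σ2 (2 * t₀))) * P.real {ω | 2 * t₀ < T ω}) := by ring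
      _ ≤ ε * F := by gcongr
  have htail : P.real {ω | τ < T ω} ≤ ε * F := by
    have h1 : c₀ * P.real {ω | τ / 2 < T ω} ≤ F := by
      refine mul_le_measureReal_exceed_at_time h.measurable hpath hTm hTnn hInd hc₀pos.le
        fun t ht => ?_
      have hmono := h.mono (by linarith : 0 ≤ τ / 2) (le_of_lt ht)
      have hστ0 : 0 < σ2 τ := hpos.trans_le (h.mono ht₀.le hτ₀)
      have hσt : 0 < σ2 t := by linarith
      rw [h.tail_eq (by linarith) hσt]
      refine gaussianTail_antitone (Real.le_sqrt_of_sq_le ?_)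
      rw [div_pow, Real.sq_sqrt hσt.le, div_le_iff₀ hσt, ← hτu]
      have : κ * σ2 τ ≤ κ * (8 * σ2 t) := by gcongr; linarith
      linarith
    calc _ ≤ ε * c₀ * P.real {ω | τ / 2 < T ω} := hTτ
      _ = ε * (c₀ * P.real {ω | τ / 2 < T ω}) := by ring
      _ ≤ ε * F := by gcongr
  have hsup := measureReal_sup_exceed_le h.measurable hpath hX0 hTm hTnn hInd (u := u) (a := a)
    (b := 1 + 111 * ε) (τ := τ) hu.le ha0 (by positivity) fun t ht htτ => by
      rcases le_total t t₀ with htt | htt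
      · have hsub : {ω | ∃ s ∈ Icc 0 t, u < X s ω} ⊆ {ω | ∃ s ∈ Icc 0 t₀, u < X s ω} := by
          rintro ω ⟨s, hs, hus⟩
          exact ⟨s, ⟨hs.1, hs.2.trans htt⟩, hus⟩
        have h1 : P.real {ω | ∃ s ∈ Icc 0 t, u < X s ω} ≤ a :=
          (measureReal_mono hsub).trans (hq t₀ le_rfl u hu
            ((mul_le_mul_of_nonneg_left (h.mono ht₀.le hτ₀) hκ.le).trans_eq hτu))
        have h2 : 0 ≤ (1 + 111 * ε) * P.real {ω | u < X t ω} := by positivity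
        linarith
      · rw [h.tail_eq ht (hpos.trans_le (h.mono ht₀.le htt))]
        exact (hq t htt u hu ((mul_le_mul_of_nonneg_left (h.mono ht htτ) hκ.le).trans_eq
          hτu)).trans (le_add_of_nonneg_left ha0)
  rw [← hF] at hsup
  linarith

end IsConvexGaussian

end

lemma isConvexGaussian_of_isCenteredGaussianCov {Ω : Type*} [MeasurableSpace Ω] {P : Measure Ω}
    {X : ℝ → Ω → ℝ} {σ2 : ℝ → ℝ}
    (hGauss : IsCenteredGaussianCov P X (fun s t => (σ2 s + σ2 t - σ2 |t - s|) / 2))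
    (hzero : σ2 0 ≤ 0) (hconv : ConvexOn ℝ (Ici 0) σ2) : IsConvexGaussian P X σ2 := by
  have h0 : σ2 0 = 0 := by
    refine hzero.antisymm ?_
    obtain ⟨v, hv, -⟩ := hGauss.2 1 (fun _ => 0) (fun _ => 1) fun _ => le_rfl
    have := v.2
    simp at hv
    linarith
  refine ⟨hGauss.1, fun s t a b hs ht => ?_, h0, hconv⟩
  obtain ⟨v, hv, hl⟩ := hGauss.2 2 ![s, t] ![a, b] (by simp [Fin.forall_fin_two, hs, ht])
  refine ⟨v, ?_, by simpa [Fin.sum_univ_two] using hl⟩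
  simp only [hv, Fin.sum_univ_two, Matrix.cons_val_zero, Matrix.cons_val_one, sub_self, abs_zero,
    h0, abs_sub_comm s t]
  ring

lemma tendsto_div_one_of_le {f g : ℝ → ℝ} (hle : ∀ u, g u ≤ f u) {K : ℝ} (hK : 0 < K)
    (hev : ∀ ε : ℝ, 0 < ε → ε ≤ 1 → ∀ᶠ u in atTop, 0 < g u ∧ f u ≤ (1 + K * ε) * g u) :
    Tendsto (fun u => f u / g u) atTop (nhds 1) := by
  refine tendsto_order.2 ⟨fun a ha => ?_, fun a ha => ?_⟩
  · filter_upwards [hev 1 one_pos le_rfl] with u hu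
    exact ha.trans_le ((one_le_div hu.1).2 (hle u))
  · have ha' : 0 < a - 1 := sub_pos.2 ha
    filter_upwards [hev (min 1 ((a - 1) / (2 * K))) (by positivity) (min_le_left _ _)] with u hu
    have h1 : K * min 1 ((a - 1) / (2 * K)) ≤ (a - 1) / 2 := by
      refine (mul_le_mul_of_nonneg_left (min_le_right _ _) hK.le).trans_eq ?_
      field_simp
    exact ((div_le_iff₀ hu.1).2 hu.2).trans_lt (by linarith)

/-- Theorem 3.1: for a centered Gaussian process with stationary increments whose
variance function satisfies A1–A3, and an independent nonnegative Weibullian time `T`,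
`ℙ(sup_{[0,T]} X > u) = ℙ(X(T) > u)(1+o(1)) = ℙ(σ_X(T)·N > u)(1+o(1))` as `u → ∞`. -/
theorem sup_over_weibullian_time {Ω : Type*} [MeasurableSpace Ω] (P : Measure Ω)
    [IsProbabilityMeasure P]
    (X : ℝ → Ω → ℝ) (σ2 : ℝ → ℝ) (αinf : ℝ) (hαinf : αinf ∈ Set.Ioo (1 : ℝ) 2)
    -- centered Gaussian with stationary increments and variance function σ2
    (hGauss : IsCenteredGaussianCov P X
      (fun s t => (σ2 s + σ2 t - σ2 |t - s|) / 2))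
    (hpath : ∀ᵐ ω ∂P, ContinuousOn (fun t => X t ω) (Set.Ici 0))
    (hX0 : ∀ᵐ ω ∂P, X 0 ω = 0)
    -- A1 : σ2 ∈ C¹([0,∞)) and σ2 is convex
    (d : ℝ → ℝ) (hdcont : ContinuousOn d (Set.Ici 0))
    (hderiv : ∀ t ∈ Set.Ici (0 : ℝ), HasDerivWithinAt σ2 (d t) (Set.Ici 0) t)
    (hconv : ConvexOn ℝ (Set.Ici 0) σ2)
    -- A2 : σ2 is regularly varying at ∞ with index αinf
    (hA2 : ∀ l : ℝ, 0 < l →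
      Tendsto (fun t => σ2 (l * t) / σ2 t) atTop (nhds (l ^ αinf)))
    -- A3
    (D : ℝ) (hD : 0 < D) (hA3 : ∀ t : ℝ, 0 ≤ t → σ2 t ≤ D * t ^ αinf)
    -- the Weibullian time T
    (T : Ω → ℝ) (hTm : Measurable T) (hTnn : ∀ ω, 0 ≤ T ω)
    (α β γ C : ℝ) (hα : 0 < α) (hβ : 0 < β) (hC : 0 < C)
    (hTW : MemW P T α β γ C)
    (hInd : Indep (MeasurableSpace.comap T inferInstance)
      (⨆ t ∈ Set.Ici (0 : ℝ), MeasurableSpace.comap (X t) inferInstance) P)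
    -- N : standard normal independent of T
    (N : Ω → ℝ) (hNm : Measurable N)
    (hNlaw : Measure.map N P = gaussianReal 0 1)
    (hNT : IndepFun T N P) :
    Tendsto (fun u : ℝ =>
        (P {ω | u < sSup ((fun s => X s ω) '' Set.Icc 0 (T ω))}).toReal /
          (P {ω | u < X (T ω) ω}).toReal) atTop (nhds 1) ∧
    Tendsto (fun u : ℝ =>
        (P {ω | u < sSup ((fun s => X s ω) '' Set.Icc 0 (T ω))}).toReal /
          (P {ω | u < Real.sqrt (σ2 (T ω)) * N ω}).toReal) atTop (nhds 1) := by
  have h : IsConvexGaussian P X σ2 := isConvexGaussian_of_isCenteredGaussianCov hGauss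
    ((hA3 0 le_rfl).trans_eq (by rw [Real.zero_rpow (by linarith [hαinf.1]), mul_zero])) hconv
  have hσ : ContinuousOn σ2 (Ici 0) := fun t ht => (hderiv t ht).continuousWithinAt
  have h1 := tendsto_div_one_of_le (measure_exceed_at_time_le_sup (P := P) hpath hTnn)
    (K := 113) (by norm_num) fun ε hε hε1 =>
      h.eventually_sup_exceed_le hpath hX0 hσ hαinf.1 hαinf.2 hA2 hTm hTnn hInd
        hTW.measureReal_pos (fun η hη => hTW.eventually_le_mul_half hα hβ hC hη) hε hε1
  refine ⟨h1, h1.congr' ?_⟩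
  filter_upwards [eventually_ge_atTop 0] with u hu
  rw [Measure.real, Measure.real,
    h.measure_exceed_eq_measure_sqrt_mul hpath hTm hTnn hInd hNm hNlaw hNT hu]
end
end
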